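/- arXiv:1702.01929 — 4 statements merged into one kernel-verified Lean document; each statement's English description precedes it below -/
import Mathlib

section
/- Consider the n-spin generalized Hopfield model with N neurons and M = N^{n-1}/(c_n log N) patterns, where n ≥ 2 is a fixed integer and c_n > 2·(2n-3)!!. Then the probability that a fixed pattern is not a fixed point of the retrieval dynamics tends to 0 as N → ∞: P(∃ i ≤ N : T̂_i(ξ^1) ≠ ξ^1_i) → 0 as N → ∞. -/
open Finset

/-- Map a Boolean to the corresponding `±1` spin value. -/
noncomputable def pm (b : Bool) : ℝ := if b then 1 else -1

open Classical in
/-- Probability of an event `E` under the uniform distribution on a finite type `Ω`. -/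
noncomputable def unifProb {Ω : Type*} [Fintype Ω] (E : Ω → Prop) : ℝ :=
  ((Finset.univ.filter E).card : ℝ) / (Fintype.card Ω : ℝ)

/-- One step of the `n`-spin retrieval dynamics of the generalized Hopfield model with
patterns `ξ^1, …, ξ^M`, evaluated at neuron `i` of the configuration `σ`:
`T̂_i(σ) = sgn(Σ_{j_1,…,j_{n-1}} σ_{j_1} ⋯ σ_{j_{n-1}} W_{i,j_1,…,j_{n-1}})` with the
`n`-spin synaptic weights `W_{i_1,…,i_n} = N^{-(n-1)} Σ_μ ξ_{i_1}^μ ⋯ ξ_{i_n}^μ`. -/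
noncomputable def hopT (n : ℕ) {M N : ℕ} (ξ : Fin M → Fin N → ℝ) (σ : Fin N → ℝ)
    (i : Fin N) : ℝ :=
  Real.sign (∑ jv : Fin (n - 1) → Fin N,
    (∏ l, σ (jv l)) * (((N : ℝ) ^ (n - 1))⁻¹ * ∑ μ, ξ μ i * ∏ l, ξ μ (jv l)))


lemma hop_fact (k : ℕ) : (2 * k).factorial = 2 ^ k * k.factorial * (2 * k - 1).doubleFactorial := by
  cases k with
  | zero => simp
  | succ d =>
    have h := Nat.factorial_eq_mul_doubleFactorial (2 * d + 1)
    have h2 := Nat.doubleFactorial_two_mul (d + 1)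
    have e : 2 * (d + 1) - 1 = 2 * d + 1 := by omega
    rw [e, ← h2]
    exact h

lemma hop_coef (j d : ℕ) : (2 * (j + d)).choose (2 * j) * (2 * j - 1).doubleFactorial
    ≤ (2 * (j + d) - 1).doubleFactorial * (j + d).choose j := by
  have h1 := Nat.choose_mul_factorial_mul_factorial (show 2 * j ≤ 2 * j + 2 * d by omega)
  have h2 := Nat.choose_mul_factorial_mul_factorial (show j ≤ j + d by omega)
  rw [Nat.add_sub_cancel_left] at h1 h2
  have f1 := hop_fact j
  have f2 := hop_fact d
  have f3 := hop_fact (j + d)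
  rw [← mul_add, f1, f2, f3, ← h2] at h1
  have hd : 1 ≤ (2 * d - 1).doubleFactorial := Nat.doubleFactorial_pos _
  have key : (2 * (j + d)).choose (2 * j) * (2 * j - 1).doubleFactorial *
      (2 * d - 1).doubleFactorial = (2 * (j + d) - 1).doubleFactorial * (j + d).choose j := by
    have hp : 0 < 2 ^ (j + d) * j.factorial * d.factorial := by positivity
    apply Nat.eq_of_mul_eq_mul_left hp
    rw [pow_add] at h1 ⊢
    linarith
  rw [← key]
  exact Nat.le_mul_of_pos_right _ hd

lemma hop_split (f : ℕ → ℝ) (k : ℕ) : ∑ i ∈ range (2 * k + 1), f i =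
    ∑ j ∈ range (k + 1), f (2 * j) + ∑ j ∈ range k, f (2 * j + 1) := by
  induction k with
  | zero => simp
  | succ k ih =>
    rw [show 2 * (k + 1) + 1 = (2 * k + 1) + 1 + 1 by ring, sum_range_succ, sum_range_succ, ih,
      sum_range_succ (fun j => f (2 * j)) (k + 1), sum_range_succ (fun j => f (2 * j + 1)) k]
    rw [show 2 * (k + 1) = 2 * k + 1 + 1 by ring]
    ring

lemma hop_binom (s : ℝ) (k : ℕ) : (1 + s) ^ (2 * k) + (-1 + s) ^ (2 * k) =
    2 * ∑ j ∈ range (k + 1), s ^ (2 * j) * ((2 * k).choose (2 * j) : ℝ) := by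
  have e : (-1 + s) ^ (2 * k) = (-s + 1) ^ (2 * k) := by
    rw [← Even.neg_pow ⟨k, by ring⟩ (-1 + s)]; congr 1; ring
  rw [e, add_comm 1 s, add_pow, add_pow, hop_split, hop_split]
  have h1 : ∀ j, (-s) ^ (2 * j) = s ^ (2 * j) := fun j => Even.neg_pow ⟨j, by ring⟩ s
  have h2 : ∀ j, (-s) ^ (2 * j + 1) = -s ^ (2 * j + 1) := fun j => Odd.neg_pow ⟨j, by ring⟩ s
  simp only [one_pow, mul_one, h1, h2, neg_mul, sum_neg_distrib]
  ring

lemma hop_sum_cons {A : Type*} [Fintype A] (N : ℕ) (f : (Fin (N + 1) → A) → ℝ) :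
    ∑ x : Fin (N + 1) → A, f x = ∑ b : A, ∑ y : Fin N → A, f (Fin.cons b y) := by
  rw [← Fintype.sum_prod_type']
  exact (Equiv.sum_comp (Fin.consEquiv (fun _ : Fin (N + 1) => A)) f).symm

lemma hop_moment (N : ℕ) : ∀ k : ℕ, ∑ x : Fin N → Bool, (∑ j, pm (x j)) ^ (2 * k) ≤
    2 ^ N * (((2 * k - 1).doubleFactorial : ℝ) * (N : ℝ) ^ k) := by
  induction N with
  | zero =>
    intro k
    rcases k with _ | k <;> simp
  | succ N ih =>
    intro k
    rw [hop_sum_cons, Fintype.sum_bool, ← sum_add_distrib]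
    simp only [Fin.sum_univ_succ, Fin.cons_zero, Fin.cons_succ]
    simp only [pm, if_true, Bool.false_eq_true, if_false]
    change ∑ x : Fin N → Bool, ((1 + ∑ j, pm (x j)) ^ (2 * k) + (-1 + ∑ j, pm (x j)) ^ (2 * k)) ≤ _
    simp only [hop_binom]
    rw [← mul_sum, sum_comm]
    simp only [← sum_mul]
    push_cast
    rw [pow_succ (2:ℝ), mul_comm ((2:ℝ)^N) 2, mul_assoc, add_pow]
    refine mul_le_mul_of_nonneg_left ?_ (by norm_num : (0:ℝ) ≤ 2)
    rw [mul_sum, mul_sum]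
    refine sum_le_sum fun j hj => ?_
    obtain ⟨d, rfl⟩ := Nat.exists_eq_add_of_le (Nat.lt_succ_iff.1 (mem_range.1 hj))
    have hcf : ((2 * (j + d)).choose (2 * j) : ℝ) * ((2 * j - 1).doubleFactorial : ℝ)
      ≤ ((2 * (j + d) - 1).doubleFactorial : ℝ) * ((j + d).choose j : ℝ) := by
      exact_mod_cast hop_coef j d
    calc _ ≤ (2 ^ N * (((2 * j - 1).doubleFactorial : ℝ) * (N : ℝ) ^ j)) *
          ((2 * (j + d)).choose (2 * j) : ℝ) :=
          mul_le_mul_of_nonneg_right (ih j) (by positivity)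
      _ = 2 ^ N * ((N : ℝ) ^ j * (((2 * (j + d)).choose (2 * j) : ℝ) *
          ((2 * j - 1).doubleFactorial : ℝ))) := by ring
      _ ≤ 2 ^ N * ((N : ℝ) ^ j * (((2 * (j + d) - 1).doubleFactorial : ℝ) *
          ((j + d).choose j : ℝ))) := by gcongr
      _ = _ := by simp; ring

lemma hop_mean (N k : ℕ) (i : Fin N) :
    0 ≤ ∑ x : Fin N → Bool, pm (x i) * (∑ j, pm (x j)) ^ k := by
  have pmn : ∀ b, pm (!b) = - pm b := by intro b; cases b <;> simp [pm]
  rcases Nat.even_or_odd k with hk | hk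
  · let e : (Fin N → Bool) ≃ (Fin N → Bool) :=
      Function.Involutive.toPerm (fun x j => !(x j)) (fun x => by ext j; simp)
    have h := Equiv.sum_comp e (fun x : Fin N → Bool => pm (x i) * (∑ j, pm (x j)) ^ k)
    have he : ∀ x j, e x j = !(x j) := fun x j => rfl
    simp only [he, pmn, sum_neg_distrib, hk.neg_pow, neg_mul] at h
    linarith
  · let e : (Fin N → Bool) ≃ (Fin N → Bool) :=
      Function.Involutive.toPerm (fun x => Function.update x i (!(x i))) (fun x => by simp)
    have h := Equiv.sum_comp e (fun x : Fin N → Bool => pm (x i) * (∑ j, pm (x j)) ^ k)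
    have he : ∀ x, e x = Function.update x i (!(x i)) := fun x => rfl
    have hs : ∀ x, ∑ j, pm (e x j) = ∑ j, pm (x j) - 2 * pm (x i) := by
      intro x
      rw [← add_sum_erase _ _ (mem_univ i), ← add_sum_erase univ (fun j => pm (x j)) (mem_univ i)]
      have : ∑ j ∈ univ.erase i, pm (e x j) = ∑ j ∈ univ.erase i, pm (x j) := by
        refine sum_congr rfl fun j hj => ?_
        rw [he, Function.update_of_ne (ne_of_mem_erase hj)]
      rw [this, he]; simp [pmn]; ring
    have h0 : 0 ≤ ∑ x : Fin N → Bool, (pm (x i) * (∑ j, pm (x j)) ^ k +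
        pm (e x i) * (∑ j, pm (e x j)) ^ k) := by
      refine sum_nonneg fun x _ => ?_
      rw [hs, he]
      simp only [Function.update_self, pmn]
      set S := ∑ j, pm (x j)
      cases x i
      · have : S ^ k ≤ (S - 2 * pm false) ^ k := hk.strictMono_pow.monotone (by simp [pm])
        simp only [pm] at this ⊢; simp at this ⊢; linarith
      · have : (S - 2 * pm true) ^ k ≤ S ^ k := hk.strictMono_pow.monotone (by simp [pm])
        simp only [pm] at this ⊢; simp at this ⊢; linarith
    rw [sum_add_distrib] at h0
    linarith

lemma hop_exp_quad (y L : ℝ) (hL : 0 ≤ L) (hy : y ≤ L) :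
    Real.exp y ≤ 1 + y + y ^ 2 / 2 * Real.exp L := by
  have hE : 1 ≤ Real.exp L := Real.one_le_exp hL
  rcases le_total y 0 with h | h
  · have h1 := Real.quadratic_le_exp_of_nonneg (x := -y) (by linarith)
    have h2 : Real.exp y * Real.exp (-y) = 1 := by rw [← Real.exp_add]; simp
    have h3 : Real.exp y ≤ 1 + y + y ^ 2 / 2 := by
      have hpos := Real.exp_pos y
      have h4 : Real.exp y * (1 + -y + (-y) ^ 2 / 2) ≤ 1 := by
        exact (mul_le_mul_of_nonneg_left h1 hpos.le).trans h2.le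
      have h5 : 0 < 1 + -y + (-y) ^ 2 / 2 := by nlinarith [sq_nonneg y]
      have h6 : 1 ≤ (1 + y + y ^ 2 / 2) * (1 + -y + (-y) ^ 2 / 2) := by
        have : (1 + y + y ^ 2 / 2) * (1 + -y + (-y) ^ 2 / 2) = 1 + y ^ 4 / 4 := by ring
        rw [this]; have : 0 ≤ y ^ 4 := by positivity
        linarith
      exact le_of_mul_le_mul_right (h4.trans h6) h5
    nlinarith [sq_nonneg y]
  · have hm : MonotoneOn (fun y : ℝ => (1 + y) * Real.exp (-y) + y ^ 2 / 2) (Set.Ici 0) := by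
      refine monotoneOn_of_deriv_nonneg (convex_Ici 0) (by fun_prop) (by fun_prop) ?_
      intro x hx
      rw [interior_Ici] at hx
      have hd : HasDerivAt (fun y : ℝ => (1 + y) * Real.exp (-y) + y ^ 2 / 2)
          (1 * Real.exp (-x) + (1 + x) * (Real.exp (-x) * (-1)) + (2 * x) / 2) x := by
        have a1 : HasDerivAt (fun y : ℝ => 1 + y) 1 x := (hasDerivAt_id x).const_add 1
        have a2 : HasDerivAt (fun y : ℝ => Real.exp (-y)) (Real.exp (-x) * (-1)) x :=
          (hasDerivAt_neg x).exp
        have a3 : HasDerivAt (fun y : ℝ => y ^ 2 / 2) ((2 * x) / 2) x := by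
          simpa using (hasDerivAt_pow 2 x).div_const 2
        exact (a1.mul a2).add a3
      rw [hd.deriv]
      have hx0 : 0 < x := hx
      have : Real.exp (-x) ≤ 1 := Real.exp_le_one_iff.2 (by linarith)
      nlinarith
    have h1 := hm (Set.mem_Ici.2 le_rfl) (Set.mem_Ici.2 h) h
    simp at h1
    have h2 : Real.exp y * Real.exp (-y) = 1 := by rw [← Real.exp_add]; simp
    have h3 : Real.exp y ≤ 1 + y + y ^ 2 / 2 * Real.exp y := by
      have := mul_le_mul_of_nonneg_left h1 (Real.exp_pos y).le
      linear_combination this + (1 + y) * h2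
    have h4 : Real.exp y ≤ Real.exp L := Real.exp_le_exp.2 hy
    have : y ^ 2 / 2 * Real.exp y ≤ y ^ 2 / 2 * Real.exp L := by gcongr
    linarith

lemma hop_exp (y L ε : ℝ) (m : ℕ) (hL : 0 ≤ L) (hy : y ≤ L) (hε : 0 < ε) :
    Real.exp y ≤ 1 + y + y ^ 2 / 2 * Real.exp ε +
      y ^ (2 * m + 2) * (Real.exp L / (2 * ε ^ (2 * m))) := by
  have hp : 0 ≤ y ^ (2 * m + 2) := Even.pow_nonneg ⟨m + 1, by ring⟩ y
  rcases le_total y ε with h | h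
  · have := hop_exp_quad y ε hε.le h
    have : 0 ≤ y ^ (2 * m + 2) * (Real.exp L / (2 * ε ^ (2 * m))) := by positivity
    linarith
  · have h1 := hop_exp_quad y L hL hy
    have h2 : ε ^ (2 * m) ≤ y ^ (2 * m) := pow_le_pow_left₀ hε.le h _
    have h3 : y ^ 2 / 2 * Real.exp L ≤ y ^ (2 * m + 2) * (Real.exp L / (2 * ε ^ (2 * m))) := by
      rw [pow_add, mul_div_assoc', le_div_iff₀ (by positivity)]
      calc _ = y ^ 2 * Real.exp L * ε ^ (2 * m) := by ring
        _ ≤ y ^ 2 * Real.exp L * y ^ (2 * m) := by gcongr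
        _ = _ := by ring
    have : 0 ≤ y ^ 2 / 2 * Real.exp ε := by positivity
    linarith

lemma hop_sign (h p : ℝ) (hp : p = 1 ∨ p = -1) (hh : Real.sign h ≠ p) : p * h ≤ 0 := by
  by_contra hc
  push Not at hc
  rcases hp with rfl | rfl
  · exact hh (Real.sign_of_pos (by linarith))
  · exact hh (Real.sign_of_neg (by linarith))

lemma hop_field (k : ℕ) {M N : ℕ} (ξ : Fin M → Fin N → ℝ) (σ : Fin N → ℝ) (i : Fin N) :
    (∑ jv : Fin k → Fin N,
    (∏ l, σ (jv l)) * (((N : ℝ) ^ k)⁻¹ * ∑ μ, ξ μ i * ∏ l, ξ μ (jv l))) =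
    ((N : ℝ) ^ k)⁻¹ * ∑ μ, ξ μ i * (∑ j, σ j * ξ μ j) ^ k := by
  simp only [Fintype.sum_pow, mul_sum, prod_mul_distrib]
  rw [sum_comm]
  refine sum_congr rfl fun μ _ => sum_congr rfl fun jv _ => ?_
  ring

lemma hop_bad (k M N : ℕ) (lam Z : ℝ) (hl : 0 ≤ lam) (hN : 0 < N) (i : Fin N)
    (hZ : ∑ x : Fin N → Bool, Real.exp (-lam * (pm (x i) * (∑ j, pm (x j)) ^ k)) ≤ 2 ^ N * Z) :
    ∑ ω : Fin (M + 1) → Fin N → Bool, 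
      (if hopT (k + 1) (fun ν j => pm (ω ν j)) (fun j => pm (ω 0 j)) i ≠ pm (ω 0 i) then (1:ℝ) else 0)
      ≤ Real.exp (-lam * (N:ℝ) ^ k) * (2 ^ N) ^ (M + 1) * Z ^ M := by
  classical
  have pp : ∀ b, pm b * pm b = 1 := by intro b; cases b <;> simp [pm]
  have hNk : (0:ℝ) < (N:ℝ) ^ k := by positivity
  have step : ∀ ω : Fin (M + 1) → Fin N → Bool,
      (if hopT (k + 1) (fun ν j => pm (ω ν j)) (fun j => pm (ω 0 j)) i ≠ pm (ω 0 i)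
        then (1:ℝ) else 0) ≤ Real.exp (-lam * (N:ℝ) ^ k) * ∏ ν : Fin M,
          Real.exp (-lam * (pm (ω 0 i) * pm (ω ν.succ i) *
            (∑ j, pm (ω 0 j) * pm (ω ν.succ j)) ^ k)) := by
    intro ω
    split_ifs with h
    · rw [hopT] at h
      have h2 := hop_sign _ _ (by cases ω 0 i <;> simp [pm]) h
      simp only [Nat.add_sub_cancel] at h2
      have hf := hop_field k (fun ν j => pm (ω ν j)) (fun j => pm (ω 0 j)) i
      beta_reduce at hf
      replace h2 : pm (ω 0 i) * (((N : ℝ) ^ k)⁻¹ * ∑ μ, pm (ω μ i) *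
          (∑ j, pm (ω 0 j) * pm (ω μ j)) ^ k) ≤ 0 := by rw [← hf]; exact h2
      rw [Fin.sum_univ_succ] at h2
      simp only [pp, sum_const, card_univ, Fintype.card_fin, nsmul_eq_mul, mul_one] at h2
      rw [← Real.exp_sum, ← Real.exp_add]
      apply Real.one_le_exp
      rw [← mul_sum, ← mul_add]
      have h3 : (N:ℝ) ^ k + ∑ ν : Fin M, pm (ω 0 i) * pm (ω ν.succ i) *
            (∑ j, pm (ω 0 j) * pm (ω ν.succ j)) ^ k ≤ 0 := by
        simp only [mul_assoc]
        rw [← mul_sum]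
        have := mul_le_mul_of_nonneg_left h2 hNk.le
        rw [mul_zero] at this
        refine le_trans (le_of_eq ?_) this
        have q := pp (ω 0 i)
        field_simp
        linear_combination (-(N:ℝ) ^ k) * q
      nlinarith
    · positivity
  refine (sum_le_sum fun ω _ => step ω).trans ?_
  rw [← mul_sum, hop_sum_cons]
  simp only [Fin.cons_zero, Fin.cons_succ]
  rw [mul_assoc]
  refine mul_le_mul_of_nonneg_left ?_ (Real.exp_pos _).le
  have inner : ∀ b : Fin N → Bool, ∑ y : Fin M → Fin N → Bool, ∏ ν : Fin M,
          Real.exp (-lam * (pm (b i) * pm (y ν i) *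
            (∑ j, pm (b j) * pm (y ν j)) ^ k)) ≤ (2 ^ N * Z) ^ M := by
    intro b
    have e1 := Fintype.sum_pow (fun y : Fin N → Bool => Real.exp (-lam * (pm (b i) * pm (y i) *
            (∑ j, pm (b j) * pm (y j)) ^ k))) M
    rw [← e1]
    refine pow_le_pow_left₀ (sum_nonneg fun _ _ => (Real.exp_pos _).le) ?_ _
    refine le_trans (le_of_eq ?_) hZ
    let e : (Fin N → Bool) ≃ (Fin N → Bool) :=
      Function.Involutive.toPerm (fun x j => (b j == x j)) (fun x => by
        ext j; beta_reduce; cases b j <;> cases x j <;> rfl)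
    rw [← Equiv.sum_comp e (fun x : Fin N → Bool =>
      Real.exp (-lam * (pm (x i) * (∑ j, pm (x j)) ^ k)))]
    have he : ∀ x j, pm (e x j) = pm (b j) * pm (x j) := by
      intro x j
      change pm (b j == x j) = _
      cases b j <;> cases x j <;> simp [pm]
    simp only [he]
  refine (sum_le_sum fun b _ => inner b).trans (le_of_eq ?_)
  simp [mul_pow]
  ring

lemma hop_prob (k M N : ℕ) (lam Z : ℝ) (hl : 0 ≤ lam) (hN : 0 < N) (hZ1 : 1 ≤ Z)
    (hZ : ∀ i : Fin N,
      ∑ x : Fin N → Bool, Real.exp (-lam * (pm (x i) * (∑ j, pm (x j)) ^ k)) ≤ 2 ^ N * Z) :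
    unifProb (Ω := Fin M → Fin N → Bool) (fun ω => ∃ μ : Fin M, (μ : ℕ) = 0 ∧ ∃ i : Fin N,
            hopT (k + 1) (fun ν j => pm (ω ν j)) (fun j => pm (ω μ j)) i ≠ pm (ω μ i)) ≤
      N * Real.exp (-lam * (N:ℝ) ^ k) * Z ^ M := by
  classical
  rcases M with _ | M
  · simp [unifProb]
    positivity
  rw [unifProb, div_le_iff₀ (by simp)]
  rw [card_filter]
  push_cast
  have : ∀ ω : Fin (M + 1) → Fin N → Bool, (if (∃ μ : Fin (M + 1), (μ : ℕ) = 0 ∧ ∃ i : Fin N,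
            hopT (k + 1) (fun ν j => pm (ω ν j)) (fun j => pm (ω μ j)) i ≠ pm (ω μ i)) then (1:ℝ) else 0)
        ≤ ∑ i : Fin N, (if hopT (k + 1) (fun ν j => pm (ω ν j)) (fun j => pm (ω 0 j)) i ≠ pm (ω 0 i) then (1:ℝ) else 0) := by
    intro ω
    have hnn : ∀ i ∈ (univ : Finset (Fin N)), (0:ℝ) ≤ (if hopT (k + 1) (fun ν j => pm (ω ν j)) (fun j => pm (ω 0 j)) i ≠ pm (ω 0 i) then (1:ℝ) else 0) := by
      intro i _; split_ifs <;> norm_num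
    split_ifs with h
    · obtain ⟨μ, h0, i, hi⟩ := h
      obtain rfl : μ = 0 := Fin.ext h0
      refine le_trans ?_ (single_le_sum hnn (mem_univ i))
      rw [if_pos hi]
    · exact sum_nonneg hnn
  refine le_trans (sum_le_sum fun ω _ => ?_) (le_trans (sum_comm (s := univ) (t := univ) (f := fun (ω : Fin (M + 1) → Fin N → Bool) (i : Fin N) => (if hopT (k + 1) (fun ν j => pm (ω ν j)) (fun j => pm (ω 0 j)) i ≠ pm (ω 0 i) then (1:ℝ) else 0))).le ?_)
  · convert this ω
  refine (sum_le_sum fun i _ => hop_bad k M N lam Z hl hN i (hZ i)).trans ?_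
  simp only [sum_const, card_univ, Fintype.card_fin, nsmul_eq_mul, Fintype.card_pi, prod_const, Fintype.card_bool]
  push_cast
  have : Z ^ M ≤ Z ^ (M + 1) := pow_le_pow_right₀ hZ1 (by omega)
  calc _ = N * Real.exp (-lam * (N:ℝ) ^ k) * (2 ^ N) ^ (M + 1) * Z ^ M := by ring
    _ ≤ N * Real.exp (-lam * (N:ℝ) ^ k) * (2 ^ N) ^ (M + 1) * Z ^ (M + 1) := by gcongr
    _ = _ := by ring

lemma hop_mgf (k m N : ℕ) (lam ε : ℝ) (hl : 0 ≤ lam) (hε : 0 < ε) (i : Fin N) :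
    ∑ x : Fin N → Bool, Real.exp (-lam * (pm (x i) * (∑ j, pm (x j)) ^ k)) ≤
      2 ^ N * (1 + (lam ^ 2 / 2 * Real.exp ε * (((2 * k - 1).doubleFactorial : ℝ) * (N:ℝ) ^ k) +
        lam ^ (2 * m + 2) * (Real.exp (lam * (N:ℝ) ^ k) / (2 * ε ^ (2 * m))) *
          (((2 * (k * (m + 1)) - 1).doubleFactorial : ℝ) * (N:ℝ) ^ (k * (m + 1))))) := by
  have pa : ∀ b, |pm b| = 1 := by intro b; cases b <;> simp [pm]
  have pe : ∀ b (r : ℕ), Even r → pm b ^ r = 1 := by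
    intro b r hr; cases b <;> simp [pm, hr]
  have step : ∀ x : Fin N → Bool, Real.exp (-lam * (pm (x i) * (∑ j, pm (x j)) ^ k)) ≤
      1 - lam * (pm (x i) * (∑ j, pm (x j)) ^ k) +
      lam ^ 2 / 2 * Real.exp ε * (∑ j, pm (x j)) ^ (2 * k) +
      lam ^ (2 * m + 2) * (Real.exp (lam * (N:ℝ) ^ k) / (2 * ε ^ (2 * m))) *
        (∑ j, pm (x j)) ^ (2 * (k * (m + 1))) := by
    intro x
    have hS : |∑ j, pm (x j)| ≤ N := by
      refine (abs_sum_le_sum_abs _ _).trans ?_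
      simp [pa]
    set S := ∑ j, pm (x j)
    have hy : -lam * (pm (x i) * S ^ k) ≤ lam * (N:ℝ) ^ k := by
      refine (le_abs_self _).trans ?_
      rw [abs_mul, abs_mul, pa, abs_neg, abs_of_nonneg hl, one_mul, abs_pow]
      gcongr
    have h := hop_exp _ _ ε m (by positivity) hy hε
    have e1 : (-lam * (pm (x i) * S ^ k)) ^ 2 = lam ^ 2 * S ^ (2 * k) := by
      rw [mul_pow, mul_pow, pe _ 2 (by decide), ← pow_mul]; ring
    have e2 : (-lam * (pm (x i) * S ^ k)) ^ (2 * m + 2) =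
        lam ^ (2 * m + 2) * S ^ (2 * (k * (m + 1))) := by
      have ev : Even (2 * m + 2) := ⟨m + 1, by ring⟩
      rw [mul_pow, mul_pow, pe _ _ ev, ← pow_mul, ev.neg_pow,
        show k * (2 * m + 2) = 2 * (k * (m + 1)) by ring]; ring
    rw [e1, e2] at h
    linarith
  refine (sum_le_sum fun x _ => step x).trans ?_
  rw [sum_add_distrib, sum_add_distrib, sum_sub_distrib, ← mul_sum, ← mul_sum, ← mul_sum]
  have h1 := mul_nonneg hl (hop_mean N k i)
  have h2 := mul_le_mul_of_nonneg_left (hop_moment N k)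
    (by positivity : 0 ≤ lam ^ 2 / 2 * Real.exp ε)
  have h3 := mul_le_mul_of_nonneg_left (hop_moment N (k * (m + 1)))
    (by positivity : 0 ≤ lam ^ (2 * m + 2) * (Real.exp (lam * (N:ℝ) ^ k) / (2 * ε ^ (2 * m))))
  have h4 : ∑ x : Fin N → Bool, (1:ℝ) = 2 ^ N := by simp
  rw [h4]
  linarith

lemma hop_main (k : ℕ) (hk : 1 ≤ k)
    (c : ℝ) (hc : 2 * (Nat.doubleFactorial (2 * k - 1) : ℝ) < c) :
    Filter.Tendsto
      (fun N : ℕ =>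
        unifProb (Ω := Fin ⌊(N : ℝ) ^ k / (c * Real.log N)⌋₊ → Fin N → Bool)
          (fun ω => ∃ μ : Fin ⌊(N : ℝ) ^ k / (c * Real.log N)⌋₊,
            (μ : ℕ) = 0 ∧ ∃ i : Fin N,
            hopT (k + 1) (fun ν j => pm (ω ν j)) (fun j => pm (ω μ j)) i ≠ pm (ω μ i)))
      Filter.atTop (nhds 0) := by
  set D : ℝ := (Nat.doubleFactorial (2 * k - 1) : ℝ) with hD
  have hDpos : 0 < D := by
    rw [hD]; exact_mod_cast Nat.doubleFactorial_pos _
  have hcpos : 0 < c := by linarith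
  obtain ⟨ε, hε, hεc⟩ : ∃ ε : ℝ, 0 < ε ∧ 2 * (D * Real.exp ε) < c := by
    refine ⟨Real.log (c / (2 * D)) / 2, ?_, ?_⟩
    · have : 0 < Real.log (c / (2 * D)) := Real.log_pos (by rw [lt_div_iff₀ (by positivity)]; linarith)
      linarith
    · have h0 : 0 < Real.log (c / (2 * D)) := Real.log_pos (by rw [lt_div_iff₀ (by positivity)]; linarith)
      have : Real.exp (Real.log (c / (2 * D)) / 2) < c / (2 * D) := by
        conv_rhs => rw [← Real.exp_log (show 0 < c / (2 * D) by positivity)]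
        exact Real.exp_lt_exp.2 (by linarith)
      rw [lt_div_iff₀ (by positivity)] at this
      linarith
  set K : ℝ := D * Real.exp ε with hK
  have hKpos : 0 < K := by positivity
  obtain ⟨a, ha⟩ : ∃ a : ℝ, a = c / K := ⟨_, rfl⟩
  have ha2 : 2 < a := by rw [ha, lt_div_iff₀ hKpos]; exact hεc
  obtain ⟨m, hm⟩ := exists_nat_ge (a + 1)
  obtain ⟨C, hC⟩ : ∃ C : ℝ, C = a ^ (2 * m + 2) / (2 * ε ^ (2 * m)) *
    ((2 * (k * (m + 1)) - 1).doubleFactorial : ℝ) / c := ⟨_, rfl⟩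
  have hCpos : 0 ≤ C := by rw [hC]; positivity
  have hlog : Filter.Tendsto (fun N : ℕ => Real.log (N : ℝ)) Filter.atTop Filter.atTop :=
    Real.tendsto_log_atTop.comp tendsto_natCast_atTop_atTop
  have hg : Filter.Tendsto (fun t : ℝ => Real.exp ((1 - a / 2) * t +
      C * (t ^ (2 * m + 2) * Real.exp (-t)))) Filter.atTop (nhds 0) := by
    refine Real.tendsto_exp_atBot.comp ?_
    refine Filter.Tendsto.atBot_add (C := C * 0) ?_ ?_
    · exact Filter.Tendsto.const_mul_atTop_of_neg (by linarith) Filter.tendsto_id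
    · exact (Real.tendsto_pow_mul_exp_neg_atTop_nhds_zero (2 * m + 2)).const_mul C
  refine squeeze_zero' (Filter.Eventually.of_forall fun N => ?_) ?_ (hg.comp hlog)
  · unfold unifProb; positivity
  filter_upwards [hlog.eventually_ge_atTop 1, Filter.eventually_ge_atTop 1] with N ht hN
  simp only [Function.comp]
  have hN0 : (0:ℝ) < N := by exact_mod_cast hN
  have hexp : Real.exp (Real.log N) = N := Real.exp_log hN0
  set t := Real.log (N:ℝ) with htd
  have hNk : (0:ℝ) < (N:ℝ) ^ k := by positivity
  set M := ⌊(N : ℝ) ^ k / (c * t)⌋₊ with hM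
  have hMle : (M:ℝ) ≤ (N : ℝ) ^ k / (c * t) := Nat.floor_le (by positivity)
  have hMle' : (M:ℝ) ≤ (N : ℝ) ^ k / c := hMle.trans (by
    gcongr; nlinarith)
  obtain ⟨lam, hlam⟩ : ∃ lam : ℝ, lam = a * t / (N:ℝ) ^ k := ⟨_, rfl⟩
  have hl0 : 0 ≤ lam := by rw [hlam]; positivity
  have hlN : lam * (N:ℝ) ^ k = a * t := by rw [hlam]; field_simp
  obtain ⟨u1, hu1⟩ : ∃ u1 : ℝ, u1 = lam ^ 2 / 2 * Real.exp ε * (D * (N:ℝ) ^ k) := ⟨_, rfl⟩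
  obtain ⟨u2, hu2⟩ : ∃ u2 : ℝ, u2 =
    lam ^ (2 * m + 2) * (Real.exp (lam * (N:ℝ) ^ k) / (2 * ε ^ (2 * m))) *
      (((2 * (k * (m + 1)) - 1).doubleFactorial : ℝ) * (N:ℝ) ^ (k * (m + 1))) := ⟨_, rfl⟩
  have hu1p : 0 ≤ u1 := by rw [hu1]; positivity
  have hu2p : 0 ≤ u2 := by rw [hu2]; positivity
  have hp := hop_prob k M N lam (1 + (u1 + u2)) hl0 hN (by linarith)
    (fun i => by rw [hu1, hu2]; exact hop_mgf k m N lam ε hl0 hε i)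
  refine hp.trans ?_
  have hb1 : (M:ℝ) * u1 ≤ a / 2 * t := by
    refine (mul_le_mul_of_nonneg_right hMle hu1p).trans (le_of_eq ?_)
    rw [hu1, hlam, ha, hK]
    field_simp
  have hb2 : (M:ℝ) * u2 ≤ C * (t ^ (2 * m + 2) * Real.exp (-t)) := by
    refine (mul_le_mul_of_nonneg_right hMle' hu2p).trans ?_
    have e : (N : ℝ) ^ k / c * u2 = C * (t ^ (2 * m + 2) *
        (Real.exp (a * t) / ((N:ℝ) ^ k) ^ m)) := by
      have gen : ∀ P E F : ℝ, 0 < P → P / c * ((a * t / P) ^ (2 * m + 2) *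
          (E / (2 * ε ^ (2 * m))) * (F * P ^ (m + 1))) =
          a ^ (2 * m + 2) / (2 * ε ^ (2 * m)) * F / c * (t ^ (2 * m + 2) * (E / P ^ m)) := by
        intro P E F hP
        rw [div_pow, mul_pow, show P ^ (2 * m + 2) = P ^ m * P ^ (m + 1) * P by ring]
        field_simp
      rw [hu2, hlN, hC, hlam, pow_mul (N:ℝ) k (m + 1)]
      exact gen _ _ _ hNk
    rw [e]
    have : Real.exp (a * t) / ((N:ℝ) ^ k) ^ m ≤ Real.exp (-t) := by
      rw [div_le_iff₀ (by positivity)]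
      have h1 : (N:ℝ) ≤ (N:ℝ) ^ k := le_self_pow₀ (by exact_mod_cast hN) (by omega)
      calc Real.exp (a * t) ≤ Real.exp (-t + m * t) := Real.exp_le_exp.2 (by nlinarith)
        _ = Real.exp (-t) * (N:ℝ) ^ m := by rw [Real.exp_add, Real.exp_nat_mul, hexp]
        _ ≤ _ := by gcongr
    gcongr
  have hb3 : (1 + (u1 + u2)) ^ M ≤ Real.exp (M * (u1 + u2)) := by
    rw [Real.exp_nat_mul]
    exact pow_le_pow_left₀ (by linarith) (by linarith [Real.add_one_le_exp (u1 + u2)]) _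
  have e4 : (N:ℝ) * Real.exp (-lam * (N:ℝ) ^ k) = Real.exp (t - a * t) := by
    rw [neg_mul, hlN, sub_eq_add_neg, Real.exp_add, hexp]
  rw [e4]
  calc _ ≤ Real.exp (t - a * t) * Real.exp (M * (u1 + u2)) := by gcongr
    _ = Real.exp (t - a * t + M * (u1 + u2)) := (Real.exp_add _ _).symm
    _ ≤ _ := Real.exp_le_exp.2 (by linarith)

/-- In the `n`-spin generalized Hopfield model (`n ≥ 2` fixed) with `N` neurons and
`M = N^{n-1}/(c_n log N)` i.i.d. uniform patterns, where `c_n > 2·(2n-3)!!`, the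
probability that the fixed pattern `ξ^1` is not a fixed point of the retrieval dynamics
tends to `0` as `N → ∞`: `P(∃ i ≤ N : T̂_i(ξ^1) ≠ ξ^1_i) → 0`. -/
theorem nspin_hopfield_fixed_pattern_stable (n : ℕ) (hn : 2 ≤ n)
    (c : ℝ) (hc : 2 * (Nat.doubleFactorial (2 * n - 3) : ℝ) < c) :
    Filter.Tendsto
      (fun N : ℕ =>
        unifProb (Ω := Fin ⌊(N : ℝ) ^ (n - 1) / (c * Real.log N)⌋₊ → Fin N → Bool)
          (fun ω => ∃ μ : Fin ⌊(N : ℝ) ^ (n - 1) / (c * Real.log N)⌋₊,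
            (μ : ℕ) = 0 ∧ ∃ i : Fin N,
            hopT n (fun ν j => pm (ω ν j)) (fun j => pm (ω μ j)) i ≠ pm (ω μ i)))
      Filter.atTop (nhds 0) := by
  obtain ⟨k, rfl⟩ : ∃ k, n = k + 1 := ⟨n - 1, by omega⟩
  have e : 2 * (k + 1) - 3 = 2 * k - 1 := by omega
  rw [e] at hc
  exact hop_main k (by omega) c hc
end

section
/- Let 0 < α < log(2)/2 = I(1)/2, M = exp(αN) + 1, and let ξ^1, …, ξ^M be M patterns chosen independently and uniformly at random from {-1,+1}^N. Then P( ∃ μ ∃ i : T_i(ξ^μ) ≠ ξ^μ_i ) → 0 as N → ∞, i.e. with probability converging to 1 all M = exp(αN)+1 patterns are simultaneously fixed points of the exponential-interaction dynamics. -/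
open Finset

/-- One step of the exponential-interaction retrieval dynamics of the generalized
Hopfield model with patterns `ξ^1, …, ξ^M`, evaluated at neuron `i` of the
configuration `σ`:
`T_i(σ) = sgn(Σ_μ [exp(ξ_i^μ + Σ_{j≠i} ξ_j^μ σ_j) − exp(−ξ_i^μ + Σ_{j≠i} ξ_j^μ σ_j)])`. -/
noncomputable def expDyn {M N : ℕ} (ξ : Fin M → Fin N → ℝ) (σ : Fin N → ℝ) (i : Fin N) : ℝ :=
  Real.sign (∑ μ,
    (Real.exp (ξ μ i + ∑ j ∈ Finset.univ.erase i, ξ μ j * σ j)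
      - Real.exp (-(ξ μ i) + ∑ j ∈ Finset.univ.erase i, ξ μ j * σ j)))

noncomputable def ovl {N : ℕ} (a b : Fin N → Bool) : ℝ := ∑ j, pm (a j) * pm (b j)

lemma pm_cases (b : Bool) : pm b = 1 ∨ pm b = -1 := by
  cases b <;> simp [pm]

lemma pm_mul_self (b : Bool) : pm b * pm b = 1 := by
  cases b <;> simp [pm]

lemma ovl_self {N : ℕ} (a : Fin N → Bool) : ovl a a = N := by
  simp [ovl, pm_mul_self]

lemma sum_exp_ovl {N : ℕ} (l : ℝ) (a : Fin N → Bool) :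
    ∑ b : Fin N → Bool, Real.exp (l * ovl a b) = (2 * Real.cosh l) ^ N := by
  have h : ∀ b : Fin N → Bool, Real.exp (l * ovl a b) = ∏ j, Real.exp (l * (pm (a j) * pm (b j))) := by
    intro b
    rw [ovl, Finset.mul_sum, Real.exp_sum]
  simp_rw [h]
  have h2 := Finset.prod_univ_sum (fun _ : Fin N => (Finset.univ : Finset Bool))
    (fun j x => Real.exp (l * (pm (a j) * pm x)))
  rw [Fintype.piFinset_univ] at h2
  rw [← h2]
  have h3 : ∀ j, ∑ x : Bool, Real.exp (l * (pm (a j) * pm x)) = 2 * Real.cosh l := by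
    intro j
    rw [Real.cosh_eq]
    rcases pm_cases (a j) with h | h <;> rw [h] <;> simp [pm] <;> ring
  simp only [h3]
  simp

lemma sum_prod_erase {M : ℕ} {A : Type*} [Fintype A] [DecidableEq A] (μ : Fin M)
    (f : Fin M → A → A → ℝ) :
    ∑ ω : Fin M → A, ∏ ν ∈ univ.erase μ, f ν (ω μ) (ω ν)
      = ∑ a, ∏ ν ∈ univ.erase μ, ∑ b, f ν a b := by
  have key : ∀ a : A, ∑ ω : Fin M → A, ∏ ν, (if ν = μ then (if ω ν = a then 1 else 0) else f ν a (ω ν))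
      = ∏ ν ∈ univ.erase μ, ∑ b, f ν a b := by
    intro a
    have h2 := Finset.prod_univ_sum (fun _ : Fin M => (Finset.univ : Finset A))
      (fun ν b => if ν = μ then (if b = a then (1:ℝ) else 0) else f ν a b)
    rw [Fintype.piFinset_univ] at h2
    rw [← h2, ← Finset.mul_prod_erase univ _ (mem_univ μ)]
    simp only [if_true, Finset.sum_ite_eq', mem_univ, one_mul]
    apply Finset.prod_congr rfl
    intro ν hν
    simp [Finset.ne_of_mem_erase hν]
  simp_rw [← key]
  rw [Finset.sum_comm]
  apply Finset.sum_congr rfl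
  intro ω _
  have : ∀ a, ∏ ν, (if ν = μ then (if ω ν = a then (1:ℝ) else 0) else f ν a (ω ν))
      = if ω μ = a then ∏ ν ∈ univ.erase μ, f ν a (ω ν) else 0 := by
    intro a
    rw [← Finset.mul_prod_erase univ _ (mem_univ μ)]
    simp only [if_true, ite_mul, one_mul, zero_mul]
    congr 1
    apply Finset.prod_congr rfl
    intro ν hν
    simp [Finset.ne_of_mem_erase hν]
  simp_rw [this]
  simp

lemma sum_pair {M : ℕ} {A : Type*} [Fintype A] [DecidableEq A] (μ ν : Fin M) (hν : ν ≠ μ)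
    (f : A → A → ℝ) (c : ℝ) (hf : ∀ a, ∑ b, f a b = Fintype.card A * c) :
    ∑ ω : Fin M → A, f (ω μ) (ω ν) = (Fintype.card A : ℝ) ^ M * c := by
  have h := sum_prod_erase μ (fun ρ a b => if ρ = ν then f a b else 1)
  have hm : ν ∈ univ.erase μ := by simp [hν]
  have e1 : ∀ ω : Fin M → A, ∏ ρ ∈ univ.erase μ, (if ρ = ν then f (ω μ) (ω ρ) else 1) = f (ω μ) (ω ν) := by
    intro ω
    rw [Finset.prod_ite_eq' , if_pos hm]
  have e2 : ∀ a : A, ∏ ρ ∈ univ.erase μ, ∑ b, (if ρ = ν then f a b else 1)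
      = (Fintype.card A : ℝ) ^ (M - 1) * c := by
    intro a
    have : ∀ ρ, ∑ b, (if ρ = ν then f a b else 1) = (Fintype.card A : ℝ) * (if ρ = ν then c else 1) := by
      intro ρ
      by_cases h : ρ = ν <;> simp [h, hf]
    simp_rw [this]
    rw [Finset.prod_mul_distrib, Finset.prod_ite_eq', if_pos hm]
    simp
  simp only [e1, e2] at h
  rw [h]
  have : M = (M - 1) + 1 := by have := μ.isLt; omega
  rw [Finset.sum_const, card_univ, nsmul_eq_mul]
  conv_rhs => rw [this, pow_succ]
  ring

lemma sum_full {M : ℕ} {A : Type*} [Fintype A] [DecidableEq A] (μ : Fin M)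
    (f : A → A → ℝ) (c : ℝ) (hf : ∀ a, ∑ b, f a b = Fintype.card A * c) :
    ∑ ω : Fin M → A, ∏ ν ∈ univ.erase μ, f (ω μ) (ω ν) = (Fintype.card A : ℝ) ^ M * c ^ (M - 1) := by
  rw [sum_prod_erase μ (fun _ => f)]
  simp only [hf, Finset.prod_const, Finset.card_erase_of_mem (mem_univ μ), card_univ, Fintype.card_fin,
    Finset.sum_const, nsmul_eq_mul]
  have : M = (M - 1) + 1 := by have := μ.isLt; omega
  conv_rhs => rw [this, pow_succ]
  simp only [Nat.add_sub_cancel]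
  ring

lemma exp_diff (b : Bool) (R : ℝ) : Real.exp (pm b + R) - Real.exp (-(pm b) + R)
    = (Real.exp 1 - Real.exp (-1)) * (pm b * Real.exp R) := by
  rw [Real.exp_add, Real.exp_add]
  rcases pm_cases b with h | h <;> rw [h] <;> simp <;> ring

lemma fixed_of_lt {M N : ℕ} (ω : Fin M → Fin N → Bool) (μ : Fin M) (i : Fin N)
    (h : ∑ ν ∈ univ.erase μ, Real.exp (ovl (ω μ) (ω ν)) < Real.exp (N - 2)) :
    expDyn (fun ν j => pm (ω ν j)) (fun j => pm (ω μ j)) i = pm (ω μ i) := by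
  unfold expDyn
  simp only [exp_diff]
  rw [← Finset.mul_sum]
  have hR : ∀ ν, ∑ j ∈ univ.erase i, pm (ω ν j) * pm (ω μ j)
      = ovl (ω μ) (ω ν) - pm (ω ν i) * pm (ω μ i) := by
    intro ν
    rw [ovl, ← Finset.add_sum_erase univ _ (mem_univ i)]
    rw [mul_comm (pm (ω ν i)), add_sub_cancel_left]
    exact Finset.sum_congr rfl (fun _ _ => mul_comm _ _)
  simp only [hR]
  rw [← Finset.add_sum_erase univ _ (mem_univ μ), ovl_self, pm_mul_self]
  have hc : 0 < Real.exp 1 - Real.exp (-1) := by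
    have : Real.exp (-1) < Real.exp 1 := Real.exp_lt_exp.2 (by norm_num)
    linarith
  have hrest : |∑ ν ∈ univ.erase μ, pm (ω ν i) * Real.exp (ovl (ω μ) (ω ν) - pm (ω ν i) * pm (ω μ i))|
      < Real.exp (N - 1) := by
    calc _ ≤ ∑ ν ∈ univ.erase μ, |pm (ω ν i) * Real.exp (ovl (ω μ) (ω ν) - pm (ω ν i) * pm (ω μ i))| :=
          Finset.abs_sum_le_sum_abs _ _
      _ ≤ ∑ ν ∈ univ.erase μ, Real.exp 1 * Real.exp (ovl (ω μ) (ω ν)) := by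
          apply Finset.sum_le_sum
          intro ν _
          rw [abs_mul, Real.abs_exp, ← Real.exp_add]
          have h1 : |pm (ω ν i)| = 1 := by rcases pm_cases (ω ν i) with h | h <;> simp [h]
          rw [h1, one_mul]
          apply Real.exp_le_exp.2
          rcases pm_cases (ω ν i) with h | h <;> rcases pm_cases (ω μ i) with h' | h' <;>
            rw [h, h'] <;> linarith
      _ = Real.exp 1 * ∑ ν ∈ univ.erase μ, Real.exp (ovl (ω μ) (ω ν)) := by rw [Finset.mul_sum]
      _ < Real.exp 1 * Real.exp (N - 2) := by
          exact mul_lt_mul_of_pos_left h (Real.exp_pos _)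
      _ = Real.exp (N - 1) := by rw [← Real.exp_add]; congr 1; ring
  rw [abs_lt] at hrest
  rcases pm_cases (ω μ i) with h' | h'
  · rw [h'] at hrest ⊢
    exact Real.sign_of_pos (mul_pos hc (by linarith))
  · rw [h'] at hrest ⊢
    exact Real.sign_of_neg (mul_neg_of_pos_of_neg hc (by linarith))

lemma exp_le_one_add_two {y : ℝ} (h0 : 0 ≤ y) (h1 : y ≤ 1) : Real.exp y ≤ 1 + 2 * y := by
  have := Real.abs_exp_sub_one_le (x := y) (by rw [abs_of_nonneg h0]; exact h1)
  rw [abs_of_nonneg h0, abs_le] at this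
  linarith [this.2]

/-- bound on bad indicator -/
lemma bad_bound {M N : ℕ} (ω : Fin M → Fin N → Bool) (μ : Fin M) (l δ : ℝ) (hl : 0 ≤ l)
    (h : Real.exp (N - 2) ≤ ∑ ν ∈ univ.erase μ, Real.exp (ovl (ω μ) (ω ν))) :
    1 ≤ ∑ ν ∈ univ.erase μ, Real.exp (-(l * ((1 - δ) * N))) * Real.exp (l * ovl (ω μ) (ω ν))
      + Real.exp (-Real.exp (δ * N - 2)) *
        ∏ ν ∈ univ.erase μ, (1 + 2 * (Real.exp (-((1 - δ) * N)) * Real.exp (1 * ovl (ω μ) (ω ν)))) := by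
  have p1 : 0 ≤ ∑ ν ∈ univ.erase μ, Real.exp (-(l * ((1 - δ) * N))) * Real.exp (l * ovl (ω μ) (ω ν)) :=
    Finset.sum_nonneg fun _ _ => by positivity
  have p2 : 0 ≤ Real.exp (-Real.exp (δ * N - 2)) *
        ∏ ν ∈ univ.erase μ, (1 + 2 * (Real.exp (-((1 - δ) * N)) * Real.exp (1 * ovl (ω μ) (ω ν)))) :=
    mul_nonneg (by positivity) (Finset.prod_nonneg fun _ _ => by positivity)
  by_cases hc : ∃ ν ∈ univ.erase μ, (1 - δ) * N ≤ ovl (ω μ) (ω ν)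
  · obtain ⟨ν, hν, hle⟩ := hc
    have : 1 ≤ Real.exp (-(l * ((1 - δ) * N))) * Real.exp (l * ovl (ω μ) (ω ν)) := by
      rw [← Real.exp_add]
      apply Real.one_le_exp
      nlinarith
    have h3 := Finset.single_le_sum (s := univ.erase μ)
      (f := fun ν => Real.exp (-(l * ((1 - δ) * N))) * Real.exp (l * ovl (ω μ) (ω ν)))
      (fun _ _ => by positivity) hν
    linarith
  · push Not at hc
    have h4 : Real.exp (Real.exp (δ * N - 2)) ≤ ∏ ν ∈ univ.erase μ,
        (1 + 2 * (Real.exp (-((1 - δ) * N)) * Real.exp (1 * ovl (ω μ) (ω ν)))) := by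
      calc _ ≤ Real.exp (∑ ν ∈ univ.erase μ, (Real.exp (-((1 - δ) * N)) * Real.exp (1 * ovl (ω μ) (ω ν)))) := by
            apply Real.exp_le_exp.2
            rw [← Finset.mul_sum]
            simp only [one_mul]
            calc _ = Real.exp (-((1 - δ) * N)) * Real.exp (N - 2) := by
                  rw [← Real.exp_add]; congr 1; ring
              _ ≤ _ := by gcongr
        _ = ∏ ν ∈ univ.erase μ, Real.exp (Real.exp (-((1 - δ) * N)) * Real.exp (1 * ovl (ω μ) (ω ν))) := by
            rw [Real.exp_sum]
        _ ≤ _ := by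
            apply Finset.prod_le_prod
            · intro _ _; positivity
            · intro ν hν
              apply exp_le_one_add_two (by positivity)
              rw [← Real.exp_add]
              apply Real.exp_le_one_iff.2
              have := hc ν hν
              linarith
    have h5 : 1 ≤ Real.exp (-Real.exp (δ * N - 2)) *
        ∏ ν ∈ univ.erase μ, (1 + 2 * (Real.exp (-((1 - δ) * N)) * Real.exp (1 * ovl (ω μ) (ω ν)))) := by
      calc (1:ℝ) = Real.exp (-Real.exp (δ * N - 2)) * Real.exp (Real.exp (δ * N - 2)) := by
            rw [← Real.exp_add]; simp
        _ ≤ _ := by gcongr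
    linarith

lemma unifProb_le {Ω : Type*} [Fintype Ω] [Nonempty Ω] (E : Ω → Prop) (G : Ω → ℝ) (hG : ∀ ω, 0 ≤ G ω)
    (h : ∀ ω, E ω → 1 ≤ G ω) (B : ℝ) (hB : ∑ ω, G ω ≤ Fintype.card Ω * B) : unifProb E ≤ B := by
  classical
  unfold unifProb
  have hc : (0:ℝ) < Fintype.card Ω := by exact_mod_cast Fintype.card_pos
  rw [div_le_iff₀ hc, mul_comm B]
  refine le_trans ?_ hB
  rw [Finset.card_eq_sum_ones, Nat.cast_sum, Finset.sum_filter]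
  apply Finset.sum_le_sum
  intro ω _
  split_ifs with hE
  · simpa using h ω hE
  · exact hG ω

lemma prob_bound (M N : ℕ) (l δ : ℝ) (hl : 0 ≤ l) :
    unifProb (Ω := Fin M → Fin N → Bool)
          (fun ω => ∃ μ, ∃ i : Fin N,
            expDyn (fun ν j => pm (ω ν j)) (fun j => pm (ω μ j)) i ≠ pm (ω μ i))
    ≤ M * ((M - 1 : ℕ) * (Real.exp (-(l * ((1 - δ) * N))) * Real.cosh l ^ N) +
      Real.exp (-Real.exp (δ * N - 2)) *
        (1 + 2 * (Real.exp (-((1 - δ) * N)) * Real.cosh 1 ^ N)) ^ (M - 1)) := by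
  have key : ∀ (k : ℝ) (a : Fin N → Bool), ∑ b : Fin N → Bool, Real.exp (k * ovl a b)
      = (Fintype.card (Fin N → Bool) : ℝ) * Real.cosh k ^ N := by
    intro k a
    rw [sum_exp_ovl, mul_pow]
    simp
  apply unifProb_le _ (fun ω => ∑ μ, (∑ ν ∈ univ.erase μ, Real.exp (-(l * ((1 - δ) * N))) * Real.exp (l * ovl (ω μ) (ω ν))
      + Real.exp (-Real.exp (δ * N - 2)) *
        ∏ ν ∈ univ.erase μ, (1 + 2 * (Real.exp (-((1 - δ) * N)) * Real.exp (1 * ovl (ω μ) (ω ν))))))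
  · intro ω
    exact Finset.sum_nonneg fun _ _ => add_nonneg (Finset.sum_nonneg fun _ _ => by positivity)
      (mul_nonneg (by positivity) (Finset.prod_nonneg fun _ _ => by positivity))
  · rintro ω ⟨μ, i, hne⟩
    have hb : Real.exp (N - 2) ≤ ∑ ν ∈ univ.erase μ, Real.exp (ovl (ω μ) (ω ν)) := by
      by_contra hlt
      exact hne (fixed_of_lt ω μ i (not_le.1 hlt))
    refine (bad_bound ω μ l δ hl hb).trans ?_
    exact Finset.single_le_sum (s := univ) (f := fun μ => ∑ ν ∈ univ.erase μ, Real.exp (-(l * ((1 - δ) * N))) * Real.exp (l * ovl (ω μ) (ω ν))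
      + Real.exp (-Real.exp (δ * N - 2)) *
        ∏ ν ∈ univ.erase μ, (1 + 2 * (Real.exp (-((1 - δ) * N)) * Real.exp (1 * ovl (ω μ) (ω ν)))))
      (fun _ _ => add_nonneg (Finset.sum_nonneg fun _ _ => by positivity)
      (mul_nonneg (by positivity) (Finset.prod_nonneg fun _ _ => by positivity))) (mem_univ μ)
  · apply le_of_eq
    rw [Finset.sum_comm]
    have hcard : (Fintype.card (Fin M → Fin N → Bool) : ℝ) = (Fintype.card (Fin N → Bool) : ℝ) ^ M := by
      rw [Fintype.card_fun]; simp
    have each : ∀ μ : Fin M, ∑ ω : Fin M → Fin N → Bool, (∑ ν ∈ univ.erase μ, Real.exp (-(l * ((1 - δ) * N))) * Real.exp (l * ovl (ω μ) (ω ν))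
      + Real.exp (-Real.exp (δ * N - 2)) *
        ∏ ν ∈ univ.erase μ, (1 + 2 * (Real.exp (-((1 - δ) * N)) * Real.exp (1 * ovl (ω μ) (ω ν)))))
        = (Fintype.card (Fin N → Bool) : ℝ) ^ M * ((M - 1 : ℕ) * (Real.exp (-(l * ((1 - δ) * N))) * Real.cosh l ^ N) +
      Real.exp (-Real.exp (δ * N - 2)) *
        (1 + 2 * (Real.exp (-((1 - δ) * N)) * Real.cosh 1 ^ N)) ^ (M - 1)) := by
      intro μ
      rw [Finset.sum_add_distrib, Finset.sum_comm, ← Finset.mul_sum]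
      rw [sum_full μ (fun a b => 1 + 2 * (Real.exp (-((1 - δ) * N)) * Real.exp (1 * ovl a b)))
        (1 + 2 * (Real.exp (-((1 - δ) * N)) * Real.cosh 1 ^ N))]
      · rw [Finset.sum_congr rfl (fun ν hν => sum_pair μ ν (Finset.ne_of_mem_erase hν)
          (fun a b => Real.exp (-(l * ((1 - δ) * N))) * Real.exp (l * ovl a b))
          (Real.exp (-(l * ((1 - δ) * N))) * Real.cosh l ^ N) ?_)]
        · rw [Finset.sum_const, Finset.card_erase_of_mem (mem_univ μ), card_univ, Fintype.card_fin, nsmul_eq_mul]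
          ring
        · intro a
          rw [← Finset.mul_sum, key]; ring
      · intro a
        rw [Finset.sum_add_distrib, ← Finset.mul_sum, ← Finset.mul_sum, key]
        rw [Finset.sum_const, card_univ, nsmul_eq_mul]
        ring
    rw [Finset.sum_congr rfl (fun μ _ => each μ), Finset.sum_const, card_univ, Fintype.card_fin, nsmul_eq_mul, hcard]
    ring

lemma exists_params (α : ℝ) (hα : α < Real.log 2 / 2) :
    ∃ l δ : ℝ, 0 ≤ l ∧ 0 < δ ∧ δ ≤ 0.15 ∧
      Real.exp (2 * α) * (Real.exp (-(l * (1 - δ))) * Real.cosh l) < 1 := by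
  have h2 : Real.exp (2 * α) < 2 := by
    rw [← Real.lt_log_iff_exp_lt (by norm_num)]; linarith
  have t1 : Filter.Tendsto (fun l : ℝ => Real.exp (2 * α) * ((1 + Real.exp (-(2 * l))) / 2)) Filter.atTop
      (nhds (Real.exp (2 * α) * ((1 + 0) / 2))) := by
    refine Filter.Tendsto.const_mul _ (Filter.Tendsto.div_const (Filter.Tendsto.const_add _ ?_) _)
    exact Real.tendsto_exp_neg_atTop_nhds_zero.comp
      (Filter.tendsto_id.const_mul_atTop (by norm_num : (0:ℝ) < 2))
  obtain ⟨l, hl, hl0⟩ := ((t1.eventually_lt_const (u := 1) (by linarith)).and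
    (Filter.eventually_ge_atTop (0:ℝ))).exists
  have hcosh : Real.exp (-l) * Real.cosh l = (1 + Real.exp (-(2 * l))) / 2 := by
    have e1 : Real.exp (-(2 * l)) = Real.exp (-l) * Real.exp (-l) := by
      rw [← Real.exp_add]; congr 1; ring
    have e2 : Real.exp (-l) * Real.exp l = 1 := by rw [← Real.exp_add]; simp
    rw [Real.cosh_eq, e1]
    linear_combination e2 / 2
  have cont : Continuous (fun δ : ℝ => Real.exp (2 * α) * (Real.exp (-(l * (1 - δ))) * Real.cosh l)) := by
    fun_prop
  have t2 := (cont.tendsto 0).mono_left (nhdsWithin_le_nhds (s := Set.Ioi 0))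
  have t3 := t2.eventually_lt_const (u := 1) (by simpa [hcosh] using hl)
  have t4 : ∀ᶠ δ : ℝ in nhdsWithin 0 (Set.Ioi 0), δ ∈ Set.Ioc (0:ℝ) 0.15 :=
    Ioc_mem_nhdsGT (by norm_num)
  obtain ⟨δ, h3, h4⟩ := (t3.and t4).exists
  exact ⟨l, δ, hl0, h4.1, h4.2, h3⟩

lemma tendsto_second (α δ : ℝ) (hδ : 0 < δ) :
    Filter.Tendsto (fun N : ℕ => 2 * Real.exp (α * N) * (Real.exp (-Real.exp (δ * N - 2)) * Real.exp 2))
      Filter.atTop (nhds 0) := by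
  have e : (fun N : ℕ => 2 * Real.exp (α * N) * (Real.exp (-Real.exp (δ * N - 2)) * Real.exp 2))
      = fun N : ℕ => (2 * Real.exp 2) * Real.exp (α * N - Real.exp (-2) * Real.exp (δ * N)) := by
    funext N
    rw [sub_eq_add_neg (α * N), Real.exp_add (α * N), ← Real.exp_add (-2)]
    rw [show -2 + δ * (N:ℝ) = δ * N - 2 by ring]
    ring
  rw [e]
  rw [show (0:ℝ) = (2 * Real.exp 2) * 0 by ring]
  apply Filter.Tendsto.const_mul
  apply Real.tendsto_exp_atBot.comp
  have hq : ∀ N : ℕ, α * N - Real.exp (-2) * Real.exp (δ * N) ≤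
      α * N - Real.exp (-2) * ((δ * N) ^ 2 / 2) := by
    intro N
    have := Real.quadratic_le_exp_of_nonneg (x := δ * N) (by positivity)
    have h3 : (δ * N) ^ 2 / 2 ≤ Real.exp (δ * N) := by
      have : 0 ≤ δ * (N:ℝ) := by positivity
      linarith
    have := mul_le_mul_of_nonneg_left h3 (Real.exp_pos (-2)).le
    linarith
  refine Filter.tendsto_atBot_mono hq ?_
  have e2 : (fun N : ℕ => α * N - Real.exp (-2) * ((δ * N) ^ 2 / 2))
      = fun N : ℕ => (N:ℝ) * (α - (Real.exp (-2) * δ ^ 2 / 2) * N) := by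
    funext N; ring
  rw [e2]
  apply Filter.Tendsto.atTop_mul_atBot₀ tendsto_natCast_atTop_atTop
  apply Filter.tendsto_atBot_add_const_left
  apply Filter.tendsto_neg_atTop_atBot.comp
  exact tendsto_natCast_atTop_atTop.const_mul_atTop (by positivity)

/-- In the exponential-interaction Hopfield model with `N` neurons and
`M = exp(αN) + 1` i.i.d. uniform patterns, where `0 < α < log(2)/2`, the probability
that some pattern is not a fixed point of the dynamics tends to `0` as `N → ∞`;
i.e. with probability converging to `1` all `M` patterns are simultaneously fixed
points of the dynamics. -/
theorem exp_hopfield_all_patterns_fixed (α : ℝ) (hα0 : 0 < α) (hα : α < Real.log 2 / 2) :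
    Filter.Tendsto
      (fun N : ℕ =>
        unifProb (Ω := Fin (⌊Real.exp (α * N)⌋₊ + 1) → Fin N → Bool)
          (fun ω => ∃ μ, ∃ i : Fin N,
            expDyn (fun ν j => pm (ω ν j)) (fun j => pm (ω μ j)) i ≠ pm (ω μ i)))
      Filter.atTop (nhds 0) := by
  obtain ⟨l, δ, hl, hδ, hδ', hr⟩ := exists_params α hα
  set r := Real.exp (2 * α) * (Real.exp (-(l * (1 - δ))) * Real.cosh l) with hrdef
  have hr0 : 0 ≤ r := by have := Real.cosh_pos l; positivity
  have T1 : Filter.Tendsto (fun N : ℕ => 2 * r ^ N) Filter.atTop (nhds 0) := by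
    simpa using (tendsto_pow_atTop_nhds_zero_of_lt_one hr0 hr).const_mul 2
  have T := T1.add (tendsto_second α δ hδ)
  rw [add_zero] at T
  refine squeeze_zero (fun N => ?_) (fun N => ?_) T
  · unfold unifProb; positivity
  · refine (prob_bound _ N l δ hl).trans ?_
    rw [Nat.add_sub_cancel]
    have hK : ((⌊Real.exp (α * N)⌋₊ : ℕ) : ℝ) ≤ Real.exp (α * N) := Nat.floor_le (Real.exp_pos _).le
    have hone : 1 ≤ Real.exp (α * N) := Real.one_le_exp (by positivity)
    have hM : ((⌊Real.exp (α * N)⌋₊ + 1 : ℕ) : ℝ) ≤ 2 * Real.exp (α * N) := by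
      push_cast; linarith
    generalize ⌊Real.exp (α * N)⌋₊ = K at hK hM ⊢
    have hcl := Real.cosh_pos l
    have hc1 := Real.cosh_pos 1
    have hrN : 2 * r ^ N = 2 * Real.exp (α * N) * (Real.exp (α * N) * (Real.exp (-(l * ((1 - δ) * N))) * Real.cosh l ^ N)) := by
      rw [hrdef, mul_pow, mul_pow, ← Real.exp_nat_mul, ← Real.exp_nat_mul]
      rw [show (N:ℝ) * (2 * α) = α * N + α * N by ring, Real.exp_add,
        show (N:ℝ) * -(l * (1 - δ)) = -(l * ((1 - δ) * N)) by ring]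
      ring
    have hq : Real.exp (α * N) * (Real.exp (-((1 - δ) * N)) * Real.cosh 1 ^ N) ≤ 1 := by
      have hch : Real.cosh 1 ≤ Real.exp (1 / 2) := by
        simpa using Real.cosh_le_exp_half_sq 1
      calc _ ≤ Real.exp (α * N) * (Real.exp (-((1 - δ) * N)) * Real.exp (1 / 2) ^ N) := by gcongr
        _ = Real.exp (N * (α - (1 - δ) + 1 / 2)) := by
          rw [← Real.exp_nat_mul, ← Real.exp_add, ← Real.exp_add]; congr 1; ring
        _ ≤ 1 := by
          apply Real.exp_le_one_iff.2
          apply mul_nonpos_of_nonneg_of_nonpos (by positivity)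
          have := Real.log_two_lt_d9
          linarith
    have hpow : (1 + 2 * (Real.exp (-((1 - δ) * N)) * Real.cosh 1 ^ N)) ^ K ≤ Real.exp 2 := by
      set q := Real.exp (-((1 - δ) * N)) * Real.cosh 1 ^ N with hqd
      have hq0 : 0 ≤ q := by positivity
      calc _ ≤ (Real.exp (2 * q)) ^ K := by
            gcongr
            linarith [Real.add_one_le_exp (2 * q)]
        _ = Real.exp (K * (2 * q)) := by rw [Real.exp_nat_mul]
        _ ≤ Real.exp 2 := by
            apply Real.exp_le_exp.2
            have := mul_le_mul_of_nonneg_right hK hq0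
            linarith
    rw [hrN, ← mul_add]
    gcongr
end

section
/- Let X_1, …, X_m be i.i.d. random variables with P(X_1 = 1) = P(X_1 = -1) = 1/2 and S_m = Σ_{i=1}^m X_i. Then for every x ∈ (0,1), lim_{m→∞} (1/m) log P( S_m > m x ) = −I(x), where I(x) = ((1+x)log(1+x) + (1-x)log(1-x))/2. -/
open Finset

/-- The Cramér rate function `I(x) = ((1+x)log(1+x) + (1-x)log(1-x))/2`
of a symmetric `±1` random variable. -/
noncomputable def rateI (x : ℝ) : ℝ :=
  ((1 + x) * Real.log (1 + x) + (1 - x) * Real.log (1 - x)) / 2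

noncomputable def cA (y : ℝ) : ℝ := (Real.log ((1 + y) / 2) + Real.log ((1 - y) / 2)) / 2

noncomputable def cT (y : ℝ) : ℝ := (Real.log ((1 + y) / 2) - Real.log ((1 - y) / 2)) / 2

noncomputable def cW (y : ℝ) (m : ℕ) (ω : Fin m → Bool) : ℝ :=
  Real.exp (m * cA y + cT y * ∑ i, pm (ω i))

theorem cA_add (y : ℝ) (h0 : 0 < y) (h1 : y < 1) : Real.exp (cA y + cT y) = (1 + y) / 2 := by
  have : cA y + cT y = Real.log ((1 + y) / 2) := by unfold cA cT; ring
  rw [this, Real.exp_log (by linarith)]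

theorem cA_sub (y : ℝ) (h0 : 0 < y) (h1 : y < 1) : Real.exp (cA y - cT y) = (1 - y) / 2 := by
  have : cA y - cT y = Real.log ((1 - y) / 2) := by unfold cA cT; ring
  rw [this, Real.exp_log (by linarith)]

theorem cA_rate (y : ℝ) (h0 : 0 < y) (h1 : y < 1) :
    cA y + cT y * y = rateI y - Real.log 2 := by
  unfold cA cT rateI
  rw [Real.log_div (by linarith) (by norm_num), Real.log_div (by linarith) (by norm_num)]
  ring

theorem cT_nonneg (y : ℝ) (h0 : 0 < y) (h1 : y < 1) : 0 ≤ cT y := by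
  unfold cT
  have := Real.log_le_log (x := (1 - y) / 2) (y := (1 + y) / 2) (by linarith) (by linarith)
  linarith

theorem sum_cons (m : ℕ) (f : (Fin (m + 1) → Bool) → ℝ) :
    ∑ ω, f ω = ∑ ω : Fin m → Bool, (f (Fin.cons true ω) + f (Fin.cons false ω)) := by
  rw [← (Fin.consEquiv (fun _ : Fin (m + 1) => Bool)).sum_comp, Fintype.sum_prod_type]
  simp [Finset.sum_add_distrib, Fin.consEquiv]

theorem cW_true (y : ℝ) (h0 : 0 < y) (h1 : y < 1) (m : ℕ) (ω : Fin m → Bool) :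
    cW y (m + 1) (Fin.cons true ω) = (1 + y) / 2 * cW y m ω := by
  rw [← cA_add y h0 h1]
  unfold cW
  rw [← Real.exp_add, Fin.sum_univ_succ]
  simp only [Fin.cons_zero, Fin.cons_succ, pm]
  push_cast
  congr 1
  ring

theorem cW_false (y : ℝ) (h0 : 0 < y) (h1 : y < 1) (m : ℕ) (ω : Fin m → Bool) :
    cW y (m + 1) (Fin.cons false ω) = (1 - y) / 2 * cW y m ω := by
  rw [← cA_sub y h0 h1]
  unfold cW
  rw [← Real.exp_add, Fin.sum_univ_succ]
  simp only [Fin.cons_zero, Fin.cons_succ, pm]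
  push_cast
  congr 1
  ring

theorem cW_sum (y : ℝ) (h0 : 0 < y) (h1 : y < 1) (m : ℕ) : ∑ ω, cW y m ω = 1 := by
  induction m with
  | zero => simp [cW]
  | succ m ih =>
    rw [sum_cons, ← ih]
    refine Finset.sum_congr rfl fun ω _ => ?_
    rw [cW_true y h0 h1, cW_false y h0 h1]; ring

theorem cW_mean (y : ℝ) (h0 : 0 < y) (h1 : y < 1) (m : ℕ) :
    ∑ ω, cW y m ω * (∑ i, pm (ω i) - m * y) = 0 := by
  induction m with
  | zero => simp
  | succ m ih =>
    rw [sum_cons, ← ih]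
    refine Finset.sum_congr rfl fun ω _ => ?_
    rw [cW_true y h0 h1, cW_false y h0 h1]
    simp only [Fin.sum_univ_succ, Fin.cons_zero, Fin.cons_succ, pm]
    push_cast
    ring

theorem cW_var (y : ℝ) (h0 : 0 < y) (h1 : y < 1) (m : ℕ) :
    ∑ ω, cW y m ω * (∑ i, pm (ω i) - m * y) ^ 2 = m * (1 - y ^ 2) := by
  induction m with
  | zero => simp
  | succ m ih =>
    have key : ((m + 1 : ℕ) : ℝ) * (1 - y ^ 2) =
        ∑ ω, (cW y m ω * (∑ i, pm (ω i) - m * y) ^ 2 + (1 - y ^ 2) * cW y m ω) := by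
      rw [Finset.sum_add_distrib, ih, ← Finset.mul_sum, cW_sum y h0 h1]
      push_cast; ring
    rw [sum_cons, key]
    refine Finset.sum_congr rfl fun ω _ => ?_
    rw [cW_true y h0 h1, cW_false y h0 h1]
    simp only [Fin.sum_univ_succ, Fin.cons_zero, Fin.cons_succ, pm]
    push_cast
    ring

open Classical in
theorem card_upper (x : ℝ) (h0 : 0 < x) (h1 : x < 1) (m : ℕ) :
    ((Finset.univ.filter (fun ω : Fin m → Bool => (m : ℝ) * x < ∑ i, pm (ω i))).card : ℝ)
      * Real.exp (m * (rateI x - Real.log 2)) ≤ 1 := by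
  rw [← cW_sum x h0 h1 m, ← nsmul_eq_mul]
  refine (Finset.card_nsmul_le_sum _ (cW x m) _ ?_).trans
    (Finset.sum_le_sum_of_subset_of_nonneg (Finset.subset_univ _) fun _ _ _ => (Real.exp_pos _).le)
  intro ω hω
  have hω := (Finset.mem_filter.1 hω).2
  rw [← cA_rate x h0 h1]
  unfold cW
  apply Real.exp_le_exp.2
  have := mul_le_mul_of_nonneg_left hω.le (cT_nonneg x h0 h1)
  linarith

open Classical in
theorem card_lower (x y : ℝ) (h0 : 0 < x) (hxy : x < y) (h1 : y < 1) (m : ℕ)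
    (hm : 2 ≤ m * (y - x) ^ 2) :
    1 / 2 ≤
    ((Finset.univ.filter (fun ω : Fin m → Bool => (m : ℝ) * x < ∑ i, pm (ω i))).card : ℝ)
      * Real.exp (m * (rateI y - Real.log 2 + cT y * (y - x))) := by
  have hy0 : 0 < y := h0.trans hxy
  have hmpos : (0 : ℝ) < m := by
    rcases (Nat.cast_nonneg m : (0 : ℝ) ≤ m).lt_or_eq with h | h
    · exact h
    · rw [← h] at hm; linarith
  set E := Real.exp (m * (rateI y - Real.log 2 + cT y * (y - x))) with hE
  have hEpos : 0 < E := Real.exp_pos _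
  have hd : 0 < m * (y - x) := mul_pos hmpos (by linarith)
  -- pointwise bound
  have pt : ∀ ω : Fin m → Bool, cW y m ω ≤
      (if (m : ℝ) * x < ∑ i, pm (ω i) then E else 0)
        + cW y m ω * (∑ i, pm (ω i) - m * y) ^ 2 / (m * (y - x)) ^ 2 := by
    intro ω
    have hW : 0 < cW y m ω := Real.exp_pos _
    by_cases hc : |∑ i, pm (ω i) - m * y| < m * (y - x)
    · have hc := abs_lt.1 hc
      rw [if_pos (by linarith [hc.1])]
      have : cW y m ω ≤ E := by
        rw [hE, ← cA_rate y hy0 h1]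
        unfold cW
        apply Real.exp_le_exp.2
        have := mul_le_mul_of_nonneg_left hc.2.le (cT_nonneg y hy0 h1)
        linarith
      have : 0 ≤ cW y m ω * (∑ i, pm (ω i) - m * y) ^ 2 / (m * (y - x)) ^ 2 := by positivity
      linarith
    · have hc := not_lt.1 hc
      have h2 : (m * (y - x)) ^ 2 ≤ (∑ i, pm (ω i) - m * y) ^ 2 := by
        rw [← sq_abs (∑ i, pm (ω i) - m * y)]
        exact pow_le_pow_left₀ hd.le hc 2
      have h3 : cW y m ω ≤ cW y m ω * (∑ i, pm (ω i) - m * y) ^ 2 / (m * (y - x)) ^ 2 := by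
        rw [le_div_iff₀ (by positivity)]
        exact mul_le_mul_of_nonneg_left h2 hW.le
      have : (0 : ℝ) ≤ (if (m : ℝ) * x < ∑ i, pm (ω i) then E else 0) := by
        split_ifs <;> [exact hEpos.le; exact le_rfl]
      linarith
  have hs := Finset.sum_le_sum fun ω (_ : ω ∈ Finset.univ) => pt ω
  rw [cW_sum y hy0 h1, Finset.sum_add_distrib, ← Finset.sum_div, cW_var y hy0 h1,
    ← Finset.sum_filter, Finset.sum_const, nsmul_eq_mul] at hs
  have : m * (1 - y ^ 2) / (m * (y - x)) ^ 2 ≤ 1 / 2 := by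
    rw [div_le_iff₀ (by positivity)]
    nlinarith [mul_le_mul_of_nonneg_left hm hmpos.le, mul_nonneg hmpos.le (sq_nonneg y)]
  linarith

/-- Cramér's theorem for sums `S_m` of `m` i.i.d. symmetric `±1` random variables
(modelled as the uniform distribution on `Fin m → Bool`): for `x ∈ (0,1)`,
`(1/m) log P(S_m > m x) → −I(x)` as `m → ∞`. -/
theorem rademacher_sum_cramer (x : ℝ) (hx : x ∈ Set.Ioo (0 : ℝ) 1) :
    Filter.Tendsto
      (fun m : ℕ =>
        (1 / (m : ℝ)) *
          Real.log (unifProb (Ω := Fin m → Bool)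
            (fun ω => (m : ℝ) * x < ∑ i, pm (ω i))))
      Filter.atTop (nhds (-(rateI x))) := by
  classical
  obtain ⟨h0, h1⟩ := hx
  -- lower bound in log form
  have low : ∀ y, x < y → y < 1 → ∀ m : ℕ, 0 < m → 2 ≤ m * (y - x) ^ 2 →
      0 < unifProb (Ω := Fin m → Bool) (fun ω => (m : ℝ) * x < ∑ i, pm (ω i)) ∧
      -(rateI y + cT y * (y - x)) - Real.log 2 / m ≤ (1 / (m : ℝ)) *
          Real.log (unifProb (Ω := Fin m → Bool)
            (fun ω => (m : ℝ) * x < ∑ i, pm (ω i))) := by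
    intro y hxy hy1 m hm0 hm
    have hmpos : (0 : ℝ) < m := by exact_mod_cast hm0
    have h := card_lower x y h0 hxy hy1 m hm
    unfold unifProb
    set N := ((Finset.univ.filter
      (fun ω : Fin m → Bool => (m : ℝ) * x < ∑ i, pm (ω i))).card : ℝ)
    have hN : 0 < N := by
      by_contra hc
      have := mul_nonpos_of_nonpos_of_nonneg (not_lt.1 hc)
        (Real.exp_pos (m * (rateI y - Real.log 2 + cT y * (y - x)))).le
      linarith
    have hl := Real.log_le_log (by norm_num) h
    rw [Real.log_mul hN.ne' (Real.exp_pos _).ne', Real.log_exp, one_div, Real.log_inv] at hl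
    simp only [Fintype.card_pi, Fintype.card_bool, Finset.prod_const, Finset.card_univ,
      Fintype.card_fin]
    push_cast
    refine ⟨by positivity, ?_⟩
    rw [Real.log_div hN.ne' (by positivity), Real.log_pow, one_div, ← div_eq_inv_mul,
      le_div_iff₀ hmpos, sub_mul, div_mul_cancel₀ _ hmpos.ne']
    linarith
  have up : ∀ m : ℕ, 0 < m →
      0 < unifProb (Ω := Fin m → Bool) (fun ω => (m : ℝ) * x < ∑ i, pm (ω i)) →
      (1 / (m : ℝ)) * Real.log (unifProb (Ω := Fin m → Bool)
            (fun ω => (m : ℝ) * x < ∑ i, pm (ω i))) ≤ -(rateI x) := by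
    intro m hm0 hpos
    have hmpos : (0 : ℝ) < m := by exact_mod_cast hm0
    have h := card_upper x h0 h1 m
    unfold unifProb at hpos ⊢
    set N := ((Finset.univ.filter
      (fun ω : Fin m → Bool => (m : ℝ) * x < ∑ i, pm (ω i))).card : ℝ) with hNd
    have hN : 0 < N := by
      have hN0 : 0 ≤ N := Nat.cast_nonneg _
      rcases hN0.lt_or_eq with h | h
      · exact h
      · rw [← h] at hpos; simp at hpos
    have hl := Real.log_le_log (mul_pos hN (Real.exp_pos _)) h
    rw [Real.log_mul hN.ne' (Real.exp_pos _).ne', Real.log_exp, Real.log_one] at hl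
    simp only [Fintype.card_pi, Fintype.card_bool, Finset.prod_const, Finset.card_univ,
      Fintype.card_fin]
    push_cast
    rw [Real.log_div hN.ne' (by positivity), Real.log_pow, one_div, ← div_eq_inv_mul,
      div_le_iff₀ hmpos]
    linarith
  have hbig : ∀ y, x < y → ∀ᶠ m : ℕ in Filter.atTop, 2 ≤ (m : ℝ) * (y - x) ^ 2 := by
    intro y hxy
    have : 0 < (y - x) ^ 2 := by have : 0 < y - x := by linarith
                                 positivity
    exact (tendsto_natCast_atTop_atTop.atTop_mul_const this).eventually_ge_atTop 2
  rw [tendsto_order]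
  constructor
  · intro c hc
    have hcont : ContinuousAt (fun y => -(rateI y + cT y * (y - x))) x := by
      have e1 : 1 + x ≠ 0 := by linarith
      have e2 : 1 - x ≠ 0 := by linarith
      have e3 : (1 + x) / 2 ≠ 0 := by positivity
      have e4 : (1 - x) / 2 ≠ 0 := div_ne_zero e2 two_ne_zero
      unfold rateI cT
      fun_prop (disch := assumption)
    have hev : ∀ᶠ y in nhdsWithin x (Set.Ioi x), c < -(rateI y + cT y * (y - x)) := by
      apply (hcont.tendsto.mono_left nhdsWithin_le_nhds).eventually_const_lt
      simpa using hc
    have hev2 : ∀ᶠ y in nhdsWithin x (Set.Ioi x), y ∈ Set.Ioo x 1 := Ioo_mem_nhdsGT h1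
    obtain ⟨y, hy, hxy, hy1⟩ := (hev.and hev2).exists
    have ht : Filter.Tendsto (fun m : ℕ => -(rateI y + cT y * (y - x)) - Real.log 2 / (m : ℝ))
        Filter.atTop (nhds (-(rateI y + cT y * (y - x)) - 0)) :=
      tendsto_const_nhds.sub (tendsto_const_div_atTop_nhds_zero_nat _)
    rw [sub_zero] at ht
    filter_upwards [ht.eventually_const_lt hy, hbig y hxy, Filter.eventually_gt_atTop 0]
      with m a b d
    exact a.trans_le (low y hxy hy1 m d b).2
  · intro c hc
    obtain ⟨y, hxy, hy1⟩ := exists_between h1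
    filter_upwards [hbig y hxy, Filter.eventually_gt_atTop 0] with m b d
    exact (up m d (low y hxy hy1 m d b).1).trans_lt hc
end

section
/- In the exponential-interaction Hopfield model with N neurons, fix ρ ∈ [0, 1/2) with ρN an integer, let ξ^1, …, ξ^M be i.i.d. uniform patterns in {-1,+1}^N, and for each μ let ξ̃^μ be uniform on the Hamming sphere S(ξ^μ, ρN). Then P( ∃ μ ∃ i : T_i(ξ̃^μ) ≠ ξ^μ_i ) ≤ N · M · P( Σ_{μ=2}^M e² · exp( ⟨ξ^μ | ξ̃^1⟩ ) > e^{N(1−2ρ)} ), where ⟨x | y⟩ = Σ_{j=1}^N x_j y_j is the inner product on {-1,+1}^N. -/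
open Finset

lemma pm_not' (b : Bool) : pm (!b) = - pm b := by
  cases b <;> simp [pm]

lemma sinh_aux (x h : ℝ) (hx : x = 1 ∨ x = -1) :
    Real.exp (x + h) - Real.exp (-x + h)
      = (Real.exp 1 - Real.exp (-1)) * (x * Real.exp h) := by
  rcases hx with rfl | rfl <;> simp only [Real.exp_add, neg_neg] <;> ring

lemma dyn_ne_iff {M N : ℕ} (ξ : Fin M → Fin N → ℝ) (σ : Fin N → ℝ) (i : Fin N) (s : ℝ)
    (hξ : ∀ ν, ξ ν i = 1 ∨ ξ ν i = -1) (hs : s = 1 ∨ s = -1) :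
    expDyn ξ σ i ≠ s ↔
      ∑ ν, s * ξ ν i * Real.exp (∑ j ∈ Finset.univ.erase i, ξ ν j * σ j) ≤ 0 := by
  have hc : 0 < Real.exp 1 - Real.exp (-1) := by
    rw [sub_pos]; apply Real.exp_lt_exp.2; norm_num
  unfold expDyn
  simp_rw [fun ν => sinh_aux (ξ ν i) (∑ j ∈ Finset.univ.erase i, ξ ν j * σ j) (hξ ν)]
  rw [← Finset.mul_sum]
  simp_rw [mul_assoc s]
  rw [← Finset.mul_sum]
  set S := ∑ ν, ξ ν i * Real.exp (∑ j ∈ Finset.univ.erase i, ξ ν j * σ j)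
  rcases lt_trichotomy S 0 with h | h | h
  · rw [Real.sign_of_neg (mul_neg_of_pos_of_neg hc h)]
    rcases hs with rfl | rfl
    · norm_num; exact h.le
    · norm_num; exact h
  · rw [h]
    rcases hs with rfl | rfl <;> norm_num
  · rw [Real.sign_of_pos (mul_pos hc h)]
    rcases hs with rfl | rfl
    · norm_num; exact h
    · norm_num; exact h.le

lemma key_aux {ι : Type*} (S : Finset ι) (s t H : ℝ) (x h : ι → ℝ)
    (hs : s = 1 ∨ s = -1) (ht : t = 1 ∨ t = -1) (hx : ∀ ν, x ν = 1 ∨ x ν = -1)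
    (h1 : Real.exp H + ∑ ν ∈ S, s * x ν * Real.exp (h ν) ≤ 0)
    (h2 : ∑ ν ∈ S, Real.exp 2 * Real.exp (h ν + x ν * t) ≤ Real.exp (H + s * t)) :
    s * t = 1 ∧ (∀ ν ∈ S, x ν = -s) ∧ Real.exp H ≤ ∑ ν ∈ S, Real.exp (h ν) := by
  have hpt : ∀ ν ∈ S, - (s * x ν * Real.exp (h ν)) ≤ Real.exp (h ν) := by
    intro ν _
    have := Real.exp_pos (h ν)
    rcases hs with rfl | rfl <;> rcases hx ν with e | e <;> rw [e] <;> linarith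
  have h3 : Real.exp H ≤ ∑ ν ∈ S, - (s * x ν * Real.exp (h ν)) := by
    rw [Finset.sum_neg_distrib]; linarith
  have h4 := Finset.sum_le_sum hpt
  have h5 : Real.exp 1 * ∑ ν ∈ S, Real.exp (h ν) ≤ Real.exp (H + s * t) := by
    refine le_trans ?_ h2
    rw [Finset.mul_sum]
    apply Finset.sum_le_sum
    intro ν _
    rw [← Real.exp_add, ← Real.exp_add]
    apply Real.exp_le_exp.2
    rcases ht with rfl | rfl <;> rcases hx ν with e | e <;> rw [e] <;> linarith
  have h6 : Real.exp (H + s * t) ≤ Real.exp 1 * Real.exp H := by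
    rw [← Real.exp_add]
    apply Real.exp_le_exp.2
    rcases ht with rfl | rfl <;> rcases hs with e | e <;> rw [e] <;> linarith
  have he := Real.exp_pos 1
  refine ⟨?_, ?_, h3.trans h4⟩
  · by_contra hne
    have hst : s * t = -1 := by
      rcases ht with rfl | rfl <;> rcases hs with rfl | rfl <;> 
        first | norm_num; done | (exfalso; apply hne; norm_num; done)
    have : Real.exp (H + s * t) < Real.exp 1 * Real.exp H := by
      rw [← Real.exp_add]
      apply Real.exp_lt_exp.2
      rw [hst]; linarith
    have := mul_le_mul_of_nonneg_left (h3.trans h4) he.le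
    linarith
  · intro ν hν
    by_contra hne
    have hlt : - (s * x ν * Real.exp (h ν)) < Real.exp (h ν) := by
      have := Real.exp_pos (h ν)
      rcases hs with rfl | rfl <;> rcases hx ν with e | e <;> rw [e] at hne ⊢ <;>
        first | linarith | (exfalso; apply hne; norm_num)
    have h7 := Finset.sum_lt_sum hpt ⟨ν, hν, hlt⟩
    have := mul_lt_mul_of_pos_left (h3.trans_lt h7) he
    linarith

abbrev HΩ (M N k : ℕ) := (Fin M → Fin N → Bool) × (Fin M → {A : Finset (Fin N) // A.card = k})

noncomputable def sg {M N k : ℕ} (ω : HΩ M N k) (μ : Fin M) (j : Fin N) : ℝ :=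
  if j ∈ (ω.2 μ).1 then -pm (ω.1 μ j) else pm (ω.1 μ j)

def errE {M N k : ℕ} (μ : Fin M) (i : Fin N) (ω : HΩ M N k) : Prop :=
  expDyn (fun ν j => pm (ω.1 ν j)) (sg ω μ) i ≠ pm (ω.1 μ i)

def strE {M N k : ℕ} (c : ℝ) (μ : Fin M) (ω : HΩ M N k) : Prop :=
  (∑ ν ∈ Finset.univ.erase μ,
    Real.exp 2 * Real.exp (∑ j, pm (ω.1 ν j) * sg ω μ j)) > Real.exp c

def flipE {M N k : ℕ} (μ : Fin M) (i : Fin N) (ω : HΩ M N k) : HΩ M N k :=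
  (fun ν j => if ν ≠ μ ∧ j = i then !(ω.1 ν j) else ω.1 ν j, ω.2)

lemma flipE_flipE {M N k : ℕ} (μ : Fin M) (i : Fin N) (ω : HΩ M N k) :
    flipE μ i (flipE μ i ω) = ω := by
  unfold flipE
  ext ν j
  · dsimp only
    split_ifs <;> simp
  · rfl

lemma sg_cases {M N k : ℕ} (ω : HΩ M N k) (μ : Fin M) (j : Fin N) :
    sg ω μ j = 1 ∨ sg ω μ j = -1 := by
  unfold sg
  rcases pm_cases (ω.1 μ j) with e | e <;> rw [e] <;> split_ifs <;> norm_num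

lemma self_inner {M N k : ℕ} (ω : HΩ M N k) (μ : Fin M) :
    ∑ j, pm (ω.1 μ j) * sg ω μ j = (N : ℝ) - 2 * k := by
  have : ∀ j, pm (ω.1 μ j) * sg ω μ j = 1 - 2 * (if j ∈ (ω.2 μ).1 then (1 : ℝ) else 0) := by
    intro j
    unfold sg
    rcases pm_cases (ω.1 μ j) with e | e <;> rw [e] <;> split_ifs <;> norm_num
  simp_rw [this]
  rw [Finset.sum_sub_distrib, ← Finset.mul_sum]
  simp [(ω.2 μ).2]

lemma flip_key {M N k : ℕ} (c : ℝ) (hc : c = (N : ℝ) - 2 * k) (μ : Fin M) (i : Fin N)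
    (ω : HΩ M N k) (h1 : errE μ i ω) (h2 : ¬ strE c μ ω) :
    strE c μ (flipE μ i ω) ∧ ¬ errE μ i (flipE μ i ω) := by
  have hsg : sg (flipE μ i ω) μ = sg ω μ := by
    funext j; simp [sg, flipE]
  have hmu : ∀ j, (flipE μ i ω).1 μ j = ω.1 μ j := by intro j; simp [flipE]
  have hh : ∀ ν, ∑ j ∈ Finset.univ.erase i, pm ((flipE μ i ω).1 ν j) * sg ω μ j
      = ∑ j ∈ Finset.univ.erase i, pm (ω.1 ν j) * sg ω μ j := by
    intro ν
    apply Finset.sum_congr rfl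
    intro j hj
    have : j ≠ i := Finset.ne_of_mem_erase hj
    simp [flipE, this]
  have hfl : ∀ ν, ν ≠ μ → pm ((flipE μ i ω).1 ν i) = - pm (ω.1 ν i) := by
    intro ν hν
    simp [flipE, hν, pm_not']
  have hfull : ∀ (ω' : HΩ M N k) ν, ∑ j, pm (ω'.1 ν j) * sg ω μ j
      = ∑ j ∈ Finset.univ.erase i, pm (ω'.1 ν j) * sg ω μ j + pm (ω'.1 ν i) * sg ω μ i :=
    fun ω' ν => (Finset.sum_erase_add _ _ (Finset.mem_univ i)).symm
  have hself := self_inner ω μ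
  rw [← hc, hfull] at hself
  have hs := pm_cases (ω.1 μ i)
  have hss : pm (ω.1 μ i) * pm (ω.1 μ i) = 1 := by
    rcases hs with e | e <;> rw [e] <;> norm_num
  unfold errE at h1 ⊢
  unfold strE at h2 ⊢
  rw [dyn_ne_iff _ _ _ _ (fun ν => pm_cases _) hs,
    ← Finset.add_sum_erase _ _ (Finset.mem_univ μ), hss, one_mul] at h1
  rw [gt_iff_lt, not_lt, ← hself] at h2
  simp_rw [hfull] at h2
  obtain ⟨k1, k2, k3⟩ := key_aux (Finset.univ.erase μ) _ _ _ (fun ν => pm (ω.1 ν i)) _ hs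
    (sg_cases ω μ i) (fun ν => pm_cases _) h1 h2
  have hfl2 : ∀ ν ∈ Finset.univ.erase μ, pm ((flipE μ i ω).1 ν i) = pm (ω.1 μ i) := by
    intro ν hν
    rw [hfl ν (Finset.ne_of_mem_erase hν)]
    have := k2 ν hν
    rw [this, neg_neg]
  have hpos := Real.exp_pos (∑ j ∈ Finset.univ.erase i, pm (ω.1 μ j) * sg ω μ j)
  rw [hsg]
  constructor
  · rw [gt_iff_lt, ← hself, k1]
    have : ∑ ν ∈ Finset.univ.erase μ,
        Real.exp 2 * Real.exp (∑ j, pm ((flipE μ i ω).1 ν j) * sg ω μ j)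
        = Real.exp 2 * Real.exp 1 * ∑ ν ∈ Finset.univ.erase μ,
          Real.exp (∑ j ∈ Finset.univ.erase i, pm (ω.1 ν j) * sg ω μ j) := by
      rw [Finset.mul_sum]
      apply Finset.sum_congr rfl
      intro ν hν
      rw [hfull, hh, hfl2 ν hν, k1, Real.exp_add]; ring
    rw [this, Real.exp_add]
    have e2 : (1 : ℝ) < Real.exp 2 := Real.one_lt_exp_iff.2 (by norm_num)
    have e1 := Real.exp_pos 1
    calc _ < Real.exp 2 * (Real.exp (∑ j ∈ Finset.univ.erase i, pm (ω.1 μ j) * sg ω μ j)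
              * Real.exp 1) := lt_mul_of_one_lt_left (mul_pos hpos e1) e2
      _ = Real.exp 2 * Real.exp 1
            * Real.exp (∑ j ∈ Finset.univ.erase i, pm (ω.1 μ j) * sg ω μ j) := by ring
      _ ≤ _ := mul_le_mul_of_nonneg_left k3 (by positivity)
  · rw [hmu, dyn_ne_iff _ _ _ _ (fun ν => pm_cases _) hs, not_le,
      ← Finset.add_sum_erase _ _ (Finset.mem_univ μ)]
    apply add_pos_of_pos_of_nonneg
    · rw [hmu, hss, one_mul]; exact Real.exp_pos _
    · apply Finset.sum_nonneg
      intro ν hν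
      rw [hfl2 ν hν, hss, one_mul]; exact (Real.exp_pos _).le

open Classical in
lemma card_err_le {M N k : ℕ} (c : ℝ) (hc : c = (N : ℝ) - 2 * k) (μ : Fin M) (i : Fin N) :
    (Finset.univ.filter (errE (k := k) μ i)).card ≤ (Finset.univ.filter (strE (N := N) (k := k) c μ)).card := by
  apply Finset.card_le_card_of_injOn (fun ω => if strE c μ ω then ω else flipE μ i ω)
  · intro ω hω
    simp only [Finset.coe_filter, Finset.mem_univ, true_and, Set.mem_ofPred_eq] at hω ⊢
    split_ifs with h
    · exact h
    · exact (flip_key c hc μ i ω hω h).1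
  · intro a ha b hb hab
    simp only [Finset.coe_filter, Finset.mem_univ, true_and, Set.mem_ofPred_eq] at ha hb
    dsimp only at hab
    split_ifs at hab with h1 h2 h2
    · exact hab
    · exact absurd (hab ▸ ha) (flip_key c hc μ i b hb h2).2
    · exact absurd (hab ▸ hb) (flip_key c hc μ i a ha h1).2
    · rw [← flipE_flipE μ i a, hab, flipE_flipE]

open Classical in
lemma card_str_eq {M N k : ℕ} [NeZero M] (c : ℝ) (μ : Fin M) :
    (Finset.univ.filter (strE (N := N) (k := k) c μ)).card
      ≤ (Finset.univ.filter (strE (N := N) (k := k) c (0 : Fin M))).card := by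
  let e : Equiv.Perm (Fin M) := Equiv.swap 0 μ
  apply Finset.card_le_card_of_injOn (fun ω : HΩ M N k => (ω.1 ∘ e, ω.2 ∘ e))
  · intro ω hω
    simp only [Finset.coe_filter, Finset.mem_univ, true_and, Set.mem_ofPred_eq] at hω ⊢
    unfold strE at hω ⊢
    have h0 : e 0 = μ := Equiv.swap_apply_left _ _
    have : ∑ ν ∈ Finset.univ.erase (0 : Fin M),
        Real.exp 2 * Real.exp (∑ j, pm (ω.1 (e ν) j) * sg ω μ j)
        = ∑ ν ∈ Finset.univ.erase μ,
        Real.exp 2 * Real.exp (∑ j, pm (ω.1 ν j) * sg ω μ j) := by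
      apply Finset.sum_equiv e
      · intro ν
        simp [← h0]
      · intro ν _
        rfl
    rw [← this] at hω
    have hsg : sg ((ω.1 ∘ e, ω.2 ∘ e) : HΩ M N k) 0 = sg ω μ := by
      funext j
      simp [sg, h0]
    rw [hsg]
    exact hω
  · intro a _ b _ hab
    have hab := Prod.mk.inj hab
    exact Prod.ext (e.surjective.injective_comp_right hab.1)
      (e.surjective.injective_comp_right hab.2)

/-- Union bound reduction for the exponential-interaction Hopfield model with `N` neurons,
`M` i.i.d. uniform patterns `ξ^1, …, ξ^M` in `{-1,+1}^N` (pattern `μ` is `pm ∘ ω.1 μ`) and,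
for each `μ`, a corrupted version `ξ̃^μ` uniform on the Hamming sphere `S(ξ^μ, ρN)`
(realized by flipping the coordinates of `ξ^μ` in an independent uniformly chosen set
`ω.2 μ` of `ρN` coordinates):
`P(∃ μ ∃ i : T_i(ξ̃^μ) ≠ ξ^μ_i) ≤ N · M · P(Σ_{μ=2}^M e² exp(⟨ξ^μ | ξ̃^1⟩) > e^{N(1−2ρ)})`,
where `⟨x|y⟩ = Σ_j x_j y_j`. -/
theorem exp_hopfield_union_bound (N M : ℕ) [NeZero M]
    (ρ : ℝ) (hρ0 : 0 ≤ ρ) (hρ : ρ < 1 / 2)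
    (k : ℕ) (hk : (k : ℝ) = ρ * N) :
    unifProb
        (Ω := (Fin M → Fin N → Bool) × (Fin M → {A : Finset (Fin N) // A.card = k}))
        (fun ω => ∃ μ, ∃ i : Fin N,
          expDyn (fun ν j => pm (ω.1 ν j))
            (fun j => if j ∈ (ω.2 μ).1 then -pm (ω.1 μ j) else pm (ω.1 μ j)) i
            ≠ pm (ω.1 μ i))
      ≤ (N : ℝ) * (M : ℝ) *
        unifProb
          (Ω := (Fin M → Fin N → Bool) × (Fin M → {A : Finset (Fin N) // A.card = k}))
          (fun ω =>
            (∑ μ ∈ Finset.univ.erase (0 : Fin M),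
                Real.exp 2 * Real.exp (∑ j, pm (ω.1 μ j) *
                  (if j ∈ (ω.2 0).1 then -pm (ω.1 0 j) else pm (ω.1 0 j))))
              > Real.exp ((N : ℝ) * (1 - 2 * ρ))) := by
  classical
  have hc : (N : ℝ) * (1 - 2 * ρ) = (N : ℝ) - 2 * k := by rw [hk]; ring
  set c := (N : ℝ) * (1 - 2 * ρ)
  change unifProb (Ω := HΩ M N k) (fun ω => ∃ μ, ∃ i, errE μ i ω)
    ≤ (N : ℝ) * M * unifProb (Ω := HΩ M N k) (strE c 0)
  unfold unifProb
  rw [← mul_div_assoc]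
  apply div_le_div_of_nonneg_right _ (Nat.cast_nonneg _)
  have hsub : (Finset.univ.filter (fun ω : HΩ M N k => ∃ μ, ∃ i, errE μ i ω))
      ⊆ Finset.univ.biUnion (fun p : Fin M × Fin N => Finset.univ.filter (errE p.1 p.2)) := by
    intro ω
    simp
  have h1 := (Finset.card_le_card hsub).trans (Finset.card_biUnion_le_card_mul _ _ _
    (fun p _ => (card_err_le c hc p.1 p.2).trans (card_str_eq c p.1)))
  rw [Finset.card_univ, Fintype.card_prod, Fintype.card_fin, Fintype.card_fin] at h1
  rw [mul_comm (N : ℝ)]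
  refine le_trans (le_of_eq ?_) (le_trans (Nat.cast_le.2 h1) (le_of_eq ?_))
  · congr!
  · push_cast
    congr!
end
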